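/- Let n ≥ 3, let b ∈ (0, 1/2], and set a = ((n−2)b² + 2b)/(2 + 2(n−2)b²) and p = (n−2)b²/(1 + (n−2)b²). Let C(p) := {R ∈ S²_B(so(n)) : R is positive semidefinite and Ric(R) − p·(tr(Ric(R))/n)·id is positive semidefinite}. Then the set ℓ_{a,b}(C(p)) is invariant under the ordinary differential equation dR/dt = R² + R^#: for every S ∈ ℓ_{a,b}(C(p)), S² + S^# ∈ T_S(ℓ_{a,b}(C(p))); moreover, S² + S^# lies in the interior of T_S(ℓ_{a,b}(C(p))) for every nonzero S ∈ ℓ_{a,b}(C(p)). -/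

import Mathlib

/-!
Common setup: we identify ⋀²ℝⁿ with the Lie algebra `so n` of real skew-symmetric
`n × n` matrices, sending `eᵢ ∧ eⱼ` to the rotation by `π/2` in the plane spanned by
`eᵢ, eⱼ`; the inner product on `so n` is `⟪A, B⟫ = -(1/2)·tr (A * B)`, and under this
identification `v ∧ w` corresponds to the skew-symmetric matrix `v wᵀ - w vᵀ`, while
the wedge `A ∧ B` of two endomorphisms of `ℝⁿ` acts on a skew matrix `M` by
`M ↦ (1/2)(A M Bᵀ + B M Aᵀ)` (the unique linear extension of
`v∧w ↦ (1/2)(Av ∧ Bw + Bv ∧ Aw)`).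
-/

noncomputable section

namespace BW

open Matrix

abbrev Mat (n : ℕ) := Matrix (Fin n) (Fin n) ℝ

/-- `so n`: the space of real skew-symmetric `n × n` matrices (≅ ⋀²ℝⁿ). -/
def so (n : ℕ) : Submodule ℝ (Mat n) where
  carrier := {A | Aᵀ = -A}
  add_mem' := by
    intro A B hA hB
    simp only [Set.mem_setOf_eq] at *
    rw [Matrix.transpose_add, hA, hB, neg_add]
  zero_mem' := by simp
  smul_mem' := by
    intro c A hA
    simp only [Set.mem_setOf_eq] at *
    rw [Matrix.transpose_smul, hA, smul_neg]

variable {n : ℕ}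

lemma mem_so_iff {A : Mat n} : A ∈ so n ↔ Aᵀ = -A := Iff.rfl

/-- The inner product `⟨A,B⟩ = -(1/2)·tr(AB)` on `so n`. -/
def ip (A B : so n) : ℝ := -(1/2) * Matrix.trace ((A : Mat n) * (B : Mat n))

/-- `ip` as a linear map in the second variable. -/
def ipL (A : so n) : so n →ₗ[ℝ] ℝ where
  toFun B := ip A B
  map_add' B C := by
    simp only [ip, Submodule.coe_add, Matrix.mul_add, Matrix.trace_add]; ring
  map_smul' c B := by
    simp only [ip, SetLike.val_smul, Matrix.mul_smul, Matrix.trace_smul, smul_eq_mul,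
      RingHom.id_apply]; ring

/-- The Lie bracket (matrix commutator) on `so n`. -/
def brk (A B : so n) : so n :=
  ⟨(A : Mat n) * (B : Mat n) - (B : Mat n) * (A : Mat n), by
    have hA : (A : Mat n)ᵀ = -(A : Mat n) := A.2
    have hB : (B : Mat n)ᵀ = -(B : Mat n) := B.2
    rw [mem_so_iff, Matrix.transpose_sub, Matrix.transpose_mul, Matrix.transpose_mul, hA, hB]
    noncomm_ring⟩

/-- Auxiliary linear map underlying `A ∧ B`. -/
def wedgeAux (A B : Mat n) : Mat n →ₗ[ℝ] Mat n where
  toFun M := (1/2 : ℝ) • (A * M * Bᵀ + B * M * Aᵀ)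
  map_add' M N := by
    simp only [mul_add, add_mul, smul_add]
    module
  map_smul' c M := by
    simp only [mul_smul_comm, smul_mul_assoc, RingHom.id_apply]
    module

lemma wedgeAux_mem (A B : Mat n) : ∀ M ∈ so n, wedgeAux A B M ∈ so n := by
  intro M hM
  rw [mem_so_iff] at hM ⊢
  show ((1/2 : ℝ) • (A * M * Bᵀ + B * M * Aᵀ))ᵀ = -((1/2 : ℝ) • (A * M * Bᵀ + B * M * Aᵀ))
  rw [Matrix.transpose_smul, Matrix.transpose_add, Matrix.transpose_mul, Matrix.transpose_mul,
    Matrix.transpose_mul, Matrix.transpose_mul, Matrix.transpose_transpose,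
    Matrix.transpose_transpose, hM]
  simp only [Matrix.neg_mul, Matrix.mul_neg, Matrix.mul_assoc, smul_neg, neg_add, smul_add]
  abel

/-- The wedge `A ∧ B` of two endomorphisms of ℝⁿ, as an endomorphism of `so n ≅ ⋀²ℝⁿ`:
the unique linear map with `(A ∧ B)(v ∧ w) = (1/2)(Av ∧ Bw + Bv ∧ Aw)`. -/
def wedge (A B : Mat n) : Module.End ℝ (so n) :=
  (wedgeAux A B).restrict (p := so n) (q := so n) (wedgeAux_mem A B)

/-- The index set of pairs `i < j`. -/
def pairs (n : ℕ) : Finset (Fin n × Fin n) := Finset.univ.filter fun p => p.1 < p.2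

/-- The standard basis vector `eᵢ` of ℝⁿ. -/
def evec (i : Fin n) : Fin n → ℝ := fun k => if k = i then 1 else 0

/-- `v ∧ w`, as an element of `so n ≅ ⋀²ℝⁿ`. -/
def vwedge (v w : Fin n → ℝ) : so n :=
  ⟨Matrix.of fun i j => v i * w j - w i * v j, by
    rw [mem_so_iff]
    ext i j
    simp only [Matrix.transpose_apply, Matrix.of_apply, Matrix.neg_apply]
    ring⟩

/-- The orthonormal basis vector `eᵢ ∧ eⱼ` of `so n ≅ ⋀²ℝⁿ`. -/
def bvec (i j : Fin n) : so n := vwedge (evec i) (evec j)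

/-- Hamilton's sharp product `R # S`: the self-adjoint endomorphism of `so n` determined by
`⟨(R#S)h, h⟩ = (1/2)·Σ_{α,β} ⟨[R(b_α), S(b_β)], h⟩·⟨[b_α, b_β], h⟩`,
where `(b_α)` is the orthonormal basis `(eᵢ ∧ eⱼ)_{i<j}` of `so n`. -/
def sharp (R S : Module.End ℝ (so n)) : Module.End ℝ (so n) :=
  (1/4 : ℝ) • ∑ p ∈ pairs n, ∑ q ∈ pairs n,
    ((ipL (brk (R (bvec p.1 p.2)) (S (bvec q.1 q.2)))).smulRight
        (brk (bvec p.1 p.2) (bvec q.1 q.2))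
      + (ipL (brk (bvec p.1 p.2) (bvec q.1 q.2))).smulRight
        (brk (R (bvec p.1 p.2)) (S (bvec q.1 q.2))))

/-- The right-hand side `R² + R^#` of Hamilton's ODE. -/
def Qode (R : Module.End ℝ (so n)) : Module.End ℝ (so n) := R * R + sharp R R

/-- The coordinates `R_{ijkl} = ⟨R(eᵢ∧eⱼ), e_k∧e_l⟩` of an endomorphism of `so n`. -/
def Rcoord (R : Module.End ℝ (so n)) (i j k l : Fin n) : ℝ := ip (R (bvec i j)) (bvec k l)

/-- Self-adjointness with respect to the inner product `ip`. -/
def selfAdjEnd (R : Module.End ℝ (so n)) : Prop := ∀ X Y : so n, ip (R X) Y = ip X (R Y)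

/-- A curvature operator: a self-adjoint endomorphism of `so n ≅ ⋀²ℝⁿ` satisfying the
first Bianchi identity.  (`isCurvOp` carves out `S²_B(so n)`.) -/
def isCurvOp (R : Module.End ℝ (so n)) : Prop :=
  selfAdjEnd R ∧
    ∀ i j k l : Fin n, Rcoord R i j k l + Rcoord R j k i l + Rcoord R k i j l = 0

/-- The Ricci tensor `Ric_{ij} = Σ_k R_{ikjk}` of `R`. -/
def RicM (R : Module.End ℝ (so n)) : Mat n := Matrix.of fun i j => ∑ k, Rcoord R i k j k

/-- `λ̄ = tr(Ric)/n`. -/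
def lamb (R : Module.End ℝ (so n)) : ℝ := Matrix.trace (RicM R) / (n : ℝ)

/-- The traceless Ricci tensor `Ric₀ = Ric - (tr Ric / n)·id`. -/
def Ric0 (R : Module.End ℝ (so n)) : Mat n := RicM R - lamb R • (1 : Mat n)

/-- `σ = tr(Ric₀²)/n`. -/
def sigmaR (R : Module.End ℝ (so n)) : ℝ := Matrix.trace (Ric0 R * Ric0 R) / (n : ℝ)

/-- `R_I = (λ̄/(n-1))·(id ∧ id)`, the projection of `R` onto `⟨I⟩`. -/
def RI (R : Module.End ℝ (so n)) : Module.End ℝ (so n) :=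
  (lamb R / ((n : ℝ) - 1)) • wedge (1 : Mat n) (1 : Mat n)

/-- `R_{Ric₀} = (2/(n-2))·(Ric₀ ∧ id)`, the projection of `R` onto `⟨Ric₀⟩`. -/
def RRic0 (R : Module.End ℝ (so n)) : Module.End ℝ (so n) :=
  (2 / ((n : ℝ) - 2)) • wedge (Ric0 R) (1 : Mat n)

/-- The linear map `ℓ_{a,b}(R) = R + 2(n-1)a·R_I + (n-2)b·R_{Ric₀}`. -/
def lab (a b : ℝ) (R : Module.End ℝ (so n)) : Module.End ℝ (so n) :=
  R + (2 * ((n : ℝ) - 1) * a) • RI R + (((n : ℝ) - 2) * b) • RRic0 R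

/-- Positive semidefiniteness of the quadratic form of an endomorphism of `so n`. -/
def posSemidefEnd (R : Module.End ℝ (so n)) : Prop := ∀ X : so n, 0 ≤ ip (R X) X

/-- Positive definiteness of the quadratic form of an endomorphism of `so n`. -/
def posDefEnd (R : Module.End ℝ (so n)) : Prop := ∀ X : so n, X ≠ 0 → 0 < ip (R X) X

/-- `R` is 2-nonnegative: the sum of its two smallest eigenvalues is nonnegative;
equivalently (Ky Fan), `q_R(X) + q_R(Y) ≥ 0` for all orthonormal pairs `X, Y`. -/
def twoNonneg (R : Module.End ℝ (so n)) : Prop :=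
  ∀ X Y : so n, ip X X = 1 → ip Y Y = 1 → ip X Y = 0 → 0 ≤ ip (R X) X + ip (R Y) Y

/-- The (Frobenius) norm of an endomorphism of `so n`, computed in the orthonormal
basis `(eᵢ ∧ eⱼ)_{i<j}`. -/
def endNorm (R : Module.End ℝ (so n)) : ℝ :=
  Real.sqrt (∑ p ∈ pairs n, ip (R (bvec p.1 p.2)) (R (bvec p.1 p.2)))

/-- The tangent cone `T_R C`: the closure of `{t·(S - R) : S ∈ C, t ≥ 0}`. -/
def tangCone (C : Set (Module.End ℝ (so n))) (R : Module.End ℝ (so n)) :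
    Set (Module.End ℝ (so n)) :=
  {X | ∀ ε > 0, ∃ S ∈ C, ∃ t : ℝ, 0 ≤ t ∧ endNorm (X - t • (S - R)) < ε}

/-- `C` is a closed subset of the space of endomorphisms of `so n`. -/
def isClosedSet (C : Set (Module.End ℝ (so n))) : Prop :=
  ∀ X, (∀ ε > 0, ∃ Y ∈ C, endNorm (X - Y) < ε) → X ∈ C

/-- The interior of `C` relative to the subspace `S²_B(so n)` of curvature operators. -/
def interiorCurv (C : Set (Module.End ℝ (so n))) : Set (Module.End ℝ (so n)) :=
  {X | isCurvOp X ∧ ∃ ε > 0, ∀ Y, isCurvOp Y → endNorm (Y - X) < ε → Y ∈ C}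

/-- Auxiliary linear map `M ↦ g M gᵀ` on matrices. -/
def conjAux (g : Mat n) : Mat n →ₗ[ℝ] Mat n where
  toFun M := g * M * gᵀ
  map_add' M N := by simp only [mul_add, add_mul]
  map_smul' c M := by simp only [mul_smul_comm, smul_mul_assoc, RingHom.id_apply]

/-- `⋀²g` : the action `M ↦ g M gᵀ` of `g` on `so n ≅ ⋀²ℝⁿ` (for `g` orthogonal this is
the second exterior power of `g`). -/
def conjSo (g : Mat n) : Module.End ℝ (so n) :=
  (conjAux g).restrict (p := so n) (q := so n) (fun M hM => by
    rw [mem_so_iff] at hM ⊢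
    show (g * M * gᵀ)ᵀ = -(g * M * gᵀ)
    rw [Matrix.transpose_mul, Matrix.transpose_mul, Matrix.transpose_transpose, hM]
    simp only [Matrix.neg_mul, Matrix.mul_neg, Matrix.mul_assoc])

/-- The action `g · R = (⋀²g) ∘ R ∘ (⋀²g)⁻¹` of an orthogonal matrix `g`
(whose inverse is `gᵀ`) on endomorphisms of `so n`. -/
def onAct (g : Mat n) (R : Module.End ℝ (so n)) : Module.End ℝ (so n) :=
  conjSo g * R * conjSo gᵀ

/-- Two sets are at Hausdorff distance at most `ε` from each other. -/
def hdClose (A B : Set (Module.End ℝ (so n))) (ε : ℝ) : Prop :=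
  (∀ X ∈ A, ∃ Y ∈ B, endNorm (X - Y) ≤ ε) ∧ ∀ Y ∈ B, ∃ X ∈ A, endNorm (X - Y) ≤ ε

/-- The truncation `C ∩ {‖R‖ ≤ 1}`. -/
def truncSet (C : Set (Module.End ℝ (so n))) : Set (Module.End ℝ (so n)) :=
  {R ∈ C | endNorm R ≤ 1}


/-- The set `C(p)` of nonnegative curvature operators with `Ric ≥ p·(tr Ric / n)·id`. -/
def Cpinch (n : ℕ) (p : ℝ) : Set (Module.End ℝ (so n)) :=
  {R | isCurvOp R ∧ posSemidefEnd R ∧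
    (RicM R - (p * (Matrix.trace (RicM R) / (n : ℝ))) • (1 : Mat n)).PosSemidef}

lemma so_apply_swap (X : so n) (i j : Fin n) : (X : Mat n) j i = -(X : Mat n) i j :=
  congrFun (congrFun X.2 i) j

lemma ip_eq_sum (X Y : so n) :
    ip X Y = (1 / 2) * ∑ i, ∑ j, (X : Mat n) i j * (Y : Mat n) i j := by
  have h : ∀ i j, (X : Mat n) i j * (Y : Mat n) j i = -((X : Mat n) i j * (Y : Mat n) i j) := by
    intro i j
    rw [so_apply_swap Y i j]; ring
  simp only [ip, Matrix.trace, Matrix.diag, Matrix.mul_apply, h, Finset.sum_neg_distrib]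
  ring

lemma ip_comm (X Y : so n) : ip X Y = ip Y X := by
  simp only [ip_eq_sum, mul_comm]

lemma ip_self_nonneg (X : so n) : 0 ≤ ip X X := by
  rw [ip_eq_sum]
  have : 0 ≤ ∑ i, ∑ j, (X : Mat n) i j * (X : Mat n) i j :=
    Finset.sum_nonneg fun i _ => Finset.sum_nonneg fun j _ => mul_self_nonneg _
  linarith

lemma bvec_apply (i j k l : Fin n) :
    (bvec i j : Mat n) k l
      = (if k = i then 1 else 0) * (if l = j then 1 else 0)
        - (if k = j then 1 else 0) * (if l = i then 1 else 0) := rfl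

lemma bvec_swap (i j : Fin n) : bvec j i = -bvec i j := by
  ext k l
  simp only [Submodule.coe_neg, Matrix.neg_apply, bvec_apply]
  ring

lemma bvec_self (i : Fin n) : bvec i i = 0 := by
  ext k l
  simp [bvec_apply]

lemma bvec_apply_comm (i j k l : Fin n) : (bvec i j : Mat n) k l = (bvec k l : Mat n) i j := by
  simp only [bvec_apply, eq_comm (a := k), eq_comm (a := l)]
  ring

lemma sum_mul_bvec (f : Fin n → Fin n → ℝ) (i j : Fin n) :
    ∑ k, ∑ l, f k l * (bvec i j : Mat n) k l = f i j - f j i := by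
  simp [bvec_apply, mul_sub, Finset.sum_sub_distrib]

lemma ip_bvec (X : so n) (i j : Fin n) : ip X (bvec i j) = (X : Mat n) i j := by
  have h := sum_mul_bvec (fun k l => (X : Mat n) k l) i j
  simp only [so_apply_swap X i j] at h
  rw [ip_eq_sum, h]; ring

lemma Rcoord_eq (R : Module.End ℝ (so n)) (i j k l : Fin n) :
    Rcoord R i j k l = (R (bvec i j) : Mat n) k l := ip_bvec _ _ _

lemma sum_smul_bvec (X : so n) : ∑ i, ∑ j, (X : Mat n) i j • bvec i j = (2 : ℝ) • X := by
  ext k l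
  have := sum_mul_bvec (fun i j => (X : Mat n) i j) k l
  simp only [AddSubmonoidClass.coe_finsetSum, Matrix.sum_apply, Submodule.coe_smul,
    Matrix.smul_apply, smul_eq_mul]
  simp only [bvec_apply_comm _ _ k l, this, so_apply_swap X k l]
  ring

lemma apply_eq_sum (R : Module.End ℝ (so n)) (X : so n) (k l : Fin n) :
    (R X : Mat n) k l = (1 / 2) * ∑ i, ∑ j, (X : Mat n) i j * Rcoord R i j k l := by
  have h := congrArg (fun Z => (R Z : Mat n) k l) (sum_smul_bvec X)
  simp only [map_sum, map_smul, AddSubmonoidClass.coe_finsetSum, Matrix.sum_apply,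
    Submodule.coe_smul, Matrix.smul_apply, smul_eq_mul, ← Rcoord_eq] at h
  rw [h]; ring

lemma ip_apply_eq_sum (R : Module.End ℝ (so n)) (X Y : so n) :
    ip (R X) Y = (1 / 4) * ∑ k, ∑ l, ∑ i, ∑ j,
      (X : Mat n) i j * Rcoord R i j k l * (Y : Mat n) k l := by
  simp only [ip_eq_sum, apply_eq_sum, Finset.mul_sum, Finset.sum_mul]
  refine Finset.sum_congr rfl fun k _ => Finset.sum_congr rfl fun l _ =>
    Finset.sum_congr rfl fun i _ => Finset.sum_congr rfl fun j _ => ?_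
  ring

lemma end_ext_Rcoord {R S : Module.End ℝ (so n)}
    (h : ∀ i j k l, Rcoord R i j k l = Rcoord S i j k l) : R = S := by
  ext X k l
  simp only [apply_eq_sum, h]

lemma Rcoord_add (R S : Module.End ℝ (so n)) (i j k l : Fin n) :
    Rcoord (R + S) i j k l = Rcoord R i j k l + Rcoord S i j k l := by
  simp [Rcoord_eq]

lemma Rcoord_sub (R S : Module.End ℝ (so n)) (i j k l : Fin n) :
    Rcoord (R - S) i j k l = Rcoord R i j k l - Rcoord S i j k l := by
  simp [Rcoord_eq]

lemma Rcoord_smul (c : ℝ) (R : Module.End ℝ (so n)) (i j k l : Fin n) :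
    Rcoord (c • R) i j k l = c * Rcoord R i j k l := by
  simp [Rcoord_eq]

lemma Rcoord_swap_left (R : Module.End ℝ (so n)) (i j k l : Fin n) :
    Rcoord R j i k l = -Rcoord R i j k l := by
  simp only [Rcoord_eq, bvec_swap i j, map_neg, Submodule.coe_neg, Matrix.neg_apply]

lemma Rcoord_swap_right (R : Module.End ℝ (so n)) (i j k l : Fin n) :
    Rcoord R i j l k = -Rcoord R i j k l := by
  simp only [Rcoord_eq, so_apply_swap _ k l]

lemma sum_comm_pairs (F : Fin n → Fin n → Fin n → Fin n → ℝ) :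
    ∑ i, ∑ j, ∑ k, ∑ l, F i j k l = ∑ i, ∑ j, ∑ k, ∑ l, F k l i j := by
  have h := Finset.sum_comm (s := Finset.univ) (t := Finset.univ)
    (f := fun x y : Fin n × Fin n => F x.1 x.2 y.1 y.2)
  simpa only [Fintype.sum_prod_type] using h

lemma selfAdjEnd_iff (R : Module.End ℝ (so n)) :
    selfAdjEnd R ↔ ∀ i j k l, Rcoord R k l i j = Rcoord R i j k l := by
  constructor
  · intro h i j k l
    rw [Rcoord, Rcoord, h, ip_comm]
  · intro h X Y
    rw [ip_comm X, ip_apply_eq_sum, ip_apply_eq_sum]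
    congr 1
    rw [sum_comm_pairs]
    refine Finset.sum_congr rfl fun i _ => Finset.sum_congr rfl fun j _ =>
      Finset.sum_congr rfl fun k _ => Finset.sum_congr rfl fun l _ => ?_
    rw [h]; ring

lemma sum_pairs (f : Fin n → Fin n → ℝ) (hs : ∀ i j, f j i = f i j) (h0 : ∀ i, f i i = 0) :
    ∑ p ∈ pairs n, f p.1 p.2 = (1 / 2) * ∑ i, ∑ j, f i j := by
  have h1 : ∑ p ∈ pairs n, f p.1 p.2 = ∑ i, ∑ j, if i < j then f i j else 0 := by
    rw [pairs, Finset.sum_filter, Fintype.sum_prod_type]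
  have h2 : ∑ i, ∑ j, (if i < j then f i j else 0) = ∑ i, ∑ j, if j < i then f i j else 0 := by
    rw [Finset.sum_comm]
    simp only [hs]
  have h3 : ∑ i, ∑ j, f i j
      = ∑ i, ∑ j, (if i < j then f i j else 0) + ∑ i, ∑ j, if j < i then f i j else 0 := by
    simp only [← Finset.sum_add_distrib]
    refine Finset.sum_congr rfl fun i _ => Finset.sum_congr rfl fun j _ => ?_
    rcases lt_trichotomy i j with h | h | h
    · simp [h, h.not_gt]
    · simp [h, h0]
    · simp [h, h.not_gt]
  rw [h3, ← h2, ← h1]; ring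

lemma Rcoord_mul (R S : Module.End ℝ (so n)) (i j k l : Fin n) :
    Rcoord (R * S) i j k l = (1 / 2) * ∑ p, ∑ q, Rcoord S i j p q * Rcoord R p q k l := by
  rw [Rcoord_eq, Module.End.mul_apply, apply_eq_sum]
  simp only [Rcoord_eq]

lemma brk_apply (X Y : so n) (i j : Fin n) :
    (brk X Y : Mat n) i j
      = ∑ m, ((X : Mat n) i m * (Y : Mat n) m j - (Y : Mat n) i m * (X : Mat n) m j) := by
  simp [brk, Matrix.mul_apply, Finset.sum_sub_distrib]

lemma brk_neg_left (X Y : so n) : brk (-X) Y = -brk X Y := by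
  ext i j; simp [brk, neg_add_eq_sub]

lemma brk_neg_right (X Y : so n) : brk X (-Y) = -brk X Y := by
  ext i j; simp [brk, neg_add_eq_sub]

lemma brk_zero_left (Y : so n) : brk 0 Y = 0 := by
  ext i j; simp [brk]

lemma brk_zero_right (X : so n) : brk X 0 = 0 := by
  ext i j; simp [brk]

lemma brk_swap (X Y : so n) : brk Y X = -brk X Y := by
  ext i j; simp [brk]

lemma sum_brk_bvec_mul (R : Module.End ℝ (so n)) (i j k l : Fin n) :
    ∑ p₁, ∑ p₂, ∑ q₁, ∑ q₂, (brk (R (bvec p₁ p₂)) (R (bvec q₁ q₂)) : Mat n) i j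
        * (brk (bvec p₁ p₂) (bvec q₁ q₂) : Mat n) k l
      = 8 * ∑ m, (brk (R (bvec k m)) (R (bvec m l)) : Mat n) i j := by
  have key : ∀ a b c d : Fin n,
      ∑ p₁, ∑ p₂, ∑ q₁, ∑ q₂, (brk (R (bvec p₁ p₂)) (R (bvec q₁ q₂)) : Mat n) i j
        * ((bvec p₁ p₂ : Mat n) a b * (bvec q₁ q₂ : Mat n) c d)
      = 4 * (brk (R (bvec a b)) (R (bvec c d)) : Mat n) i j := by
    intro a b c d
    have h1 : ∀ p₁ p₂, ∑ q₁, ∑ q₂, (brk (R (bvec p₁ p₂)) (R (bvec q₁ q₂)) : Mat n) i j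
        * ((bvec p₁ p₂ : Mat n) a b * (bvec q₁ q₂ : Mat n) c d)
        = (2 * (brk (R (bvec p₁ p₂)) (R (bvec c d)) : Mat n) i j) * (bvec a b : Mat n) p₁ p₂ := by
      intro p₁ p₂
      have := sum_mul_bvec (fun q₁ q₂ => (brk (R (bvec p₁ p₂)) (R (bvec q₁ q₂)) : Mat n) i j
        * (bvec p₁ p₂ : Mat n) a b) c d
      simp only [bvec_swap c d, map_neg, brk_neg_right, Submodule.coe_neg, Matrix.neg_apply] at this
      simp only [← mul_assoc, bvec_apply_comm _ _ c d]
      rw [this, bvec_apply_comm _ _ a b]; ring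
    simp only [h1]
    rw [sum_mul_bvec (fun p₁ p₂ => 2 * (brk (R (bvec p₁ p₂)) (R (bvec c d)) : Mat n) i j) a b]
    simp only [bvec_swap a b, map_neg, brk_neg_left, Submodule.coe_neg, Matrix.neg_apply]
    ring
  have h2 : ∀ p₁ p₂ q₁ q₂ : Fin n, (brk (R (bvec p₁ p₂)) (R (bvec q₁ q₂)) : Mat n) i j
        * (brk (bvec p₁ p₂) (bvec q₁ q₂) : Mat n) k l
      = ∑ m, ((brk (R (bvec p₁ p₂)) (R (bvec q₁ q₂)) : Mat n) i j
          * ((bvec p₁ p₂ : Mat n) k m * (bvec q₁ q₂ : Mat n) m l)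
        - (brk (R (bvec p₁ p₂)) (R (bvec q₁ q₂)) : Mat n) i j
          * ((bvec p₁ p₂ : Mat n) m l * (bvec q₁ q₂ : Mat n) k m)) := by
    intro p₁ p₂ q₁ q₂
    rw [brk_apply (bvec p₁ p₂), Finset.mul_sum]
    refine Finset.sum_congr rfl fun m _ => ?_
    ring
  simp only [h2]
  have h3 : ∀ F : Fin n → Fin n → Fin n → Fin n → Fin n → ℝ,
      ∑ p₁, ∑ p₂, ∑ q₁, ∑ q₂, ∑ m, F p₁ p₂ q₁ q₂ m
        = ∑ m, ∑ p₁, ∑ p₂, ∑ q₁, ∑ q₂, F p₁ p₂ q₁ q₂ m := by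
    intro F
    have h := Finset.sum_comm (s := Finset.univ) (t := Finset.univ)
      (f := fun (x : Fin n × Fin n × Fin n × Fin n) (m : Fin n) =>
        F x.1 x.2.1 x.2.2.1 x.2.2.2 m)
    simpa only [Fintype.sum_prod_type] using h
  rw [h3, Finset.mul_sum]
  refine Finset.sum_congr rfl fun m _ => ?_
  simp only [Finset.sum_sub_distrib, key]
  rw [brk_swap (R (bvec k m))]
  simp only [Submodule.coe_neg, Matrix.neg_apply]
  ring

lemma Rcoord_sharp (R : Module.End ℝ (so n)) (hR : selfAdjEnd R) (i j k l : Fin n) :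
    Rcoord (sharp R R) i j k l = ∑ p, ∑ q, (Rcoord R k p i q * Rcoord R l p j q
      - Rcoord R k p j q * Rcoord R l p i q) := by
  rw [selfAdjEnd_iff] at hR
  have h0 : Rcoord (sharp R R) i j k l = (1 / 4) * ∑ p ∈ pairs n, ∑ q ∈ pairs n,
      ((brk (R (bvec p.1 p.2)) (R (bvec q.1 q.2)) : Mat n) i j
        * (brk (bvec p.1 p.2) (bvec q.1 q.2) : Mat n) k l
      + (brk (R (bvec p.1 p.2)) (R (bvec q.1 q.2)) : Mat n) k l
        * (brk (bvec p.1 p.2) (bvec q.1 q.2) : Mat n) i j) := by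
    simp only [Rcoord_eq, sharp, LinearMap.smul_apply, LinearMap.sum_apply, LinearMap.add_apply,
      LinearMap.smulRight_apply, ipL, LinearMap.coe_mk, AddHom.coe_mk, ip_bvec,
      Submodule.coe_smul, AddSubmonoidClass.coe_finsetSum, Matrix.smul_apply, Matrix.sum_apply,
      Submodule.coe_add, Matrix.add_apply, smul_eq_mul]
    congr 1
    refine Finset.sum_congr rfl fun p _ => Finset.sum_congr rfl fun q _ => ?_
    ring
  have hq : ∀ p : Fin n × Fin n, ∑ q ∈ pairs n,
      ((brk (R (bvec p.1 p.2)) (R (bvec q.1 q.2)) : Mat n) i j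
        * (brk (bvec p.1 p.2) (bvec q.1 q.2) : Mat n) k l
      + (brk (R (bvec p.1 p.2)) (R (bvec q.1 q.2)) : Mat n) k l
        * (brk (bvec p.1 p.2) (bvec q.1 q.2) : Mat n) i j)
      = (1 / 2) * ∑ q₁, ∑ q₂, ((brk (R (bvec p.1 p.2)) (R (bvec q₁ q₂)) : Mat n) i j
        * (brk (bvec p.1 p.2) (bvec q₁ q₂) : Mat n) k l
      + (brk (R (bvec p.1 p.2)) (R (bvec q₁ q₂)) : Mat n) k l
        * (brk (bvec p.1 p.2) (bvec q₁ q₂) : Mat n) i j) := by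
    intro p
    rw [← sum_pairs (fun q₁ q₂ => ((brk (R (bvec p.1 p.2)) (R (bvec q₁ q₂)) : Mat n) i j
        * (brk (bvec p.1 p.2) (bvec q₁ q₂) : Mat n) k l
      + (brk (R (bvec p.1 p.2)) (R (bvec q₁ q₂)) : Mat n) k l
        * (brk (bvec p.1 p.2) (bvec q₁ q₂) : Mat n) i j))]
    · intro q₁ q₂
      simp only [bvec_swap q₁ q₂, map_neg, brk_neg_right, Submodule.coe_neg, Matrix.neg_apply,
        neg_mul_neg]
    · intro q
      simp [bvec_self, brk_zero_right]
  rw [h0]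
  simp only [hq]
  rw [sum_pairs (fun p₁ p₂ => (1 / 2) * ∑ q₁, ∑ q₂,
      ((brk (R (bvec p₁ p₂)) (R (bvec q₁ q₂)) : Mat n) i j
        * (brk (bvec p₁ p₂) (bvec q₁ q₂) : Mat n) k l
      + (brk (R (bvec p₁ p₂)) (R (bvec q₁ q₂)) : Mat n) k l
        * (brk (bvec p₁ p₂) (bvec q₁ q₂) : Mat n) i j))]
  rotate_left
  · intro p₁ p₂
    simp only [bvec_swap p₁ p₂, map_neg, brk_neg_left, Submodule.coe_neg, Matrix.neg_apply,
      neg_mul_neg]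
  · intro p
    simp [bvec_self, brk_zero_left]
  simp only [← Finset.mul_sum, Finset.sum_add_distrib, sum_brk_bvec_mul]
  have e1 : ∑ m, (brk (R (bvec k m)) (R (bvec m l)) : Mat n) i j
      = ∑ p, ∑ q, (Rcoord R k p i q * Rcoord R l p j q - Rcoord R k p j q * Rcoord R l p i q) := by
    refine Finset.sum_congr rfl fun m _ => ?_
    rw [brk_apply]
    refine Finset.sum_congr rfl fun u _ => ?_
    simp only [← Rcoord_eq]
    rw [Rcoord_swap_left R l m, Rcoord_swap_left R l m, Rcoord_swap_right R l m j u,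
      Rcoord_swap_right R k m j u]
    ring
  have e2 : ∑ m, (brk (R (bvec i m)) (R (bvec m j)) : Mat n) k l
      = ∑ p, ∑ q, (Rcoord R k p i q * Rcoord R l p j q - Rcoord R k p j q * Rcoord R l p i q) := by
    rw [Finset.sum_comm]
    refine Finset.sum_congr rfl fun m _ => ?_
    rw [brk_apply]
    refine Finset.sum_congr rfl fun u _ => ?_
    simp only [← Rcoord_eq]
    rw [Rcoord_swap_left R j m, Rcoord_swap_left R j m, Rcoord_swap_right R j m l u,
      Rcoord_swap_right R i m l u, hR k u i m, hR l u j m, hR k u j m, hR l u i m]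
    ring
  rw [e1, e2]
  ring

/-- Algebraic curvature tensors on `ℝⁿ`, in coordinates. -/
structure IsCurvTensor (T : Fin n → Fin n → Fin n → Fin n → ℝ) : Prop where
  swap_left : ∀ i j k l, T j i k l = -T i j k l
  pair : ∀ i j k l, T k l i j = T i j k l
  bianchi : ∀ i j k l, T i j k l + T j k i l + T k i j l = 0

lemma IsCurvTensor.swap_right {T : Fin n → Fin n → Fin n → Fin n → ℝ} (hT : IsCurvTensor T)
    (i j k l : Fin n) : T i j l k = -T i j k l := by
  rw [← hT.pair i j l k, hT.swap_left, hT.pair]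

lemma isCurvOp_iff (R : Module.End ℝ (so n)) : isCurvOp R ↔ IsCurvTensor (Rcoord R) := by
  rw [isCurvOp, selfAdjEnd_iff]
  exact ⟨fun h => ⟨Rcoord_swap_left R, h.1, h.2⟩, fun h => ⟨h.pair, h.bianchi⟩⟩

/-- The coordinates of `A ∧ B`. -/
def wedgeTensor (A B : Mat n) (i j k l : Fin n) : ℝ :=
  (1 / 2) * (A k i * B l j - A k j * B l i + B k i * A l j - B k j * A l i)

/-- The Ricci contraction of a tensor. -/
def ricTensor (T : Fin n → Fin n → Fin n → Fin n → ℝ) : Mat n :=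
  Matrix.of fun i j => ∑ k, T i k j k

/-- The contraction `Σ_{kl} T_{ikjl} M_{kl}` of a tensor with a matrix. -/
def contractTensor (T : Fin n → Fin n → Fin n → Fin n → ℝ) (M : Mat n) : Mat n :=
  Matrix.of fun i j => ∑ k, ∑ l, T i k j l * M k l

/-- The bilinear form whose diagonal gives the coordinates of `R² + R^#`. -/
def quadTensor (T U : Fin n → Fin n → Fin n → Fin n → ℝ) (i j k l : Fin n) : ℝ :=
  (1 / 2) * ∑ p, ∑ q, T i j p q * U p q k l
    + ∑ p, ∑ q, (T k p i q * U l p j q - T k p j q * U l p i q)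

lemma Rcoord_wedge (A B : Mat n) (i j k l : Fin n) :
    Rcoord (wedge A B) i j k l = wedgeTensor A B i j k l := by
  have h : ∀ C D : Mat n, (C * (bvec i j : Mat n) * Dᵀ) k l = C k i * D l j - C k j * D l i := by
    intro C D
    rw [← sum_mul_bvec (fun p q => C k p * D l q) i j]
    simp only [Matrix.mul_apply, Matrix.transpose_apply, Finset.sum_mul]
    rw [Finset.sum_comm]
    refine Finset.sum_congr rfl fun p _ => Finset.sum_congr rfl fun q _ => ?_
    ring
  rw [Rcoord_eq]
  change ((1 / 2 : ℝ) • (A * (bvec i j : Mat n) * Bᵀ + B * (bvec i j : Mat n) * Aᵀ)) k l = _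
  rw [Matrix.smul_apply, Matrix.add_apply, h, h, wedgeTensor, smul_eq_mul]
  ring

lemma RicM_eq_ricTensor (R : Module.End ℝ (so n)) : RicM R = ricTensor (Rcoord R) := rfl

lemma isCurvTensor_wedgeTensor {A B : Mat n} (hA : ∀ i j, A j i = A i j)
    (hB : ∀ i j, B j i = B i j) : IsCurvTensor (wedgeTensor A B) where
  swap_left i j k l := by simp only [wedgeTensor]; ring
  pair i j k l := by
    simp only [wedgeTensor, hA i k, hA j l, hA i l, hA j k, hB i k, hB j l, hB i l, hB j k]
    ring
  bianchi i j k l := by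
    simp only [wedgeTensor, hA i k, hA j k, hA i j, hB i k, hB j k, hB i j]
    ring

lemma isCurvOp_wedge {A B : Mat n} (hA : ∀ i j, A j i = A i j) (hB : ∀ i j, B j i = B i j) :
    isCurvOp (wedge A B) := by
  rw [isCurvOp_iff]
  have h : Rcoord (wedge A B) = wedgeTensor A B := by
    funext i j k l; exact Rcoord_wedge A B i j k l
  rw [h]
  exact isCurvTensor_wedgeTensor hA hB

lemma isCurvOp_add {R S : Module.End ℝ (so n)} (hR : isCurvOp R) (hS : isCurvOp S) :
    isCurvOp (R + S) := by
  rw [isCurvOp_iff] at *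
  refine ⟨Rcoord_swap_left _, fun i j k l => ?_, fun i j k l => ?_⟩
  · rw [Rcoord_add, Rcoord_add, hR.pair, hS.pair]
  · simp only [Rcoord_add]
    linear_combination hR.bianchi i j k l + hS.bianchi i j k l

lemma isCurvOp_smul {R : Module.End ℝ (so n)} (c : ℝ) (hR : isCurvOp R) : isCurvOp (c • R) := by
  rw [isCurvOp_iff] at *
  refine ⟨Rcoord_swap_left _, fun i j k l => ?_, fun i j k l => ?_⟩
  · rw [Rcoord_smul, Rcoord_smul, hR.pair]
  · simp only [Rcoord_smul]
    linear_combination c * hR.bianchi i j k l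

lemma Rcoord_Qode {R : Module.End ℝ (so n)} (hR : selfAdjEnd R) (i j k l : Fin n) :
    Rcoord (Qode R) i j k l = quadTensor (Rcoord R) (Rcoord R) i j k l := by
  rw [Qode, Rcoord_add, Rcoord_mul, Rcoord_sharp R hR, quadTensor]

section quadratic

variable {T : Fin n → Fin n → Fin n → Fin n → ℝ}

/-- Hamilton's contraction `Σ_{pq} T_{ipjq} T_{kplq}`. -/
def hamB (T : Fin n → Fin n → Fin n → Fin n → ℝ) (i j k l : Fin n) : ℝ :=
  ∑ p, ∑ q, T i p j q * T k p l q

lemma hamB_pair (i j k l : Fin n) : hamB T k l i j = hamB T i j k l := by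
  simp only [hamB, mul_comm]

lemma hamB_swap (hT : IsCurvTensor T) (i j k l : Fin n) : hamB T j i l k = hamB T i j k l := by
  rw [hamB, Finset.sum_comm, hamB]
  refine Finset.sum_congr rfl fun p _ => Finset.sum_congr rfl fun q _ => ?_
  rw [hT.pair i p j q, hT.pair k p l q]

lemma quadTensor_self (hT : IsCurvTensor T) (i j k l : Fin n) :
    quadTensor T T i j k l
      = hamB T i j k l - hamB T i j l k + hamB T i k j l - hamB T i l j k := by
  have h1 : ∑ p, ∑ q, T i j p q * T p q k l
      = hamB T i j k l - hamB T i j l k - hamB T j i k l + hamB T j i l k := by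
    simp only [hamB, ← Finset.sum_add_distrib, ← Finset.sum_sub_distrib]
    refine Finset.sum_congr rfl fun p _ => Finset.sum_congr rfl fun q _ => ?_
    have e1 : T i j p q = T i p j q - T j p i q := by
      linear_combination hT.bianchi i j p q - hT.swap_left i p j q
    have e2 : T p q k l = T k p l q - T l p k q := by
      rw [hT.pair k l p q]
      linear_combination hT.bianchi k l p q - hT.swap_left k p l q
    rw [e1, e2]; ring
  have h2 : ∑ p, ∑ q, (T k p i q * T l p j q - T k p j q * T l p i q)
      = hamB T k i l j - hamB T k j l i := by
    simp only [hamB, Finset.sum_sub_distrib]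
  rw [quadTensor, h1, h2, hamB_swap hT i j k l, hamB_swap hT i j l k, hamB_swap hT i k j l,
    ← hamB_pair k j l i, hamB_swap hT i l j k]
  ring

lemma isCurvTensor_quadTensor (hT : IsCurvTensor T) : IsCurvTensor (quadTensor T T) where
  swap_left i j k l := by
    simp only [quadTensor_self hT]
    rw [hamB_swap hT i j l k, hamB_swap hT i j k l, hamB_pair i l j k, hamB_pair i k j l]
    ring
  pair i j k l := by
    simp only [quadTensor_self hT]
    rw [hamB_pair i j k l, ← hamB_pair k l j i, hamB_swap hT i j l k, hamB_swap hT i k j l,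
      ← hamB_pair k j l i, hamB_swap hT i l j k]
  bianchi i j k l := by
    simp only [quadTensor_self hT]
    linear_combination hamB_pair (T := T) j l k i + hamB_swap hT j k l i - hamB_swap hT i k j l
      - hamB_pair (T := T) i j k l + hamB_swap hT i j l k + hamB_pair (T := T) i l j k

lemma ricTensor_quadTensor (hT : IsCurvTensor T) :
    ricTensor (quadTensor T T) = contractTensor T (ricTensor T) := by
  ext i j
  simp only [ricTensor, contractTensor, Matrix.of_apply, quadTensor_self hT]
  have h1 : ∑ k, hamB T i j k k = ∑ p, ∑ q, T i p j q * ∑ k, T p k q k := by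
    simp only [hamB]
    rw [Finset.sum_comm]
    refine Finset.sum_congr rfl fun p _ => ?_
    rw [Finset.sum_comm]
    refine Finset.sum_congr rfl fun q _ => ?_
    rw [Finset.mul_sum]
    refine Finset.sum_congr rfl fun k _ => ?_
    rw [hT.swap_left p k k q, hT.swap_right p k q k]; ring
  have h2 : ∑ k, hamB T i k j k = 2 * ∑ k, hamB T i k k j := by
    have e : ∑ k, hamB T i k j k = ∑ k, hamB T i k k j
        + ∑ k, ∑ p, ∑ q, T i p k q * T j k p q := by
      simp only [hamB, ← Finset.sum_add_distrib]
      refine Finset.sum_congr rfl fun k _ => Finset.sum_congr rfl fun p _ =>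
        Finset.sum_congr rfl fun q _ => ?_
      linear_combination T i p k q * (hT.bianchi j p k q - hT.swap_left k p j q
        - hT.swap_left j k p q)
    have e' : ∑ k, ∑ p, ∑ q, T i p k q * T j k p q = ∑ k, hamB T i k k j := by
      simp only [hamB]
      have c : ∀ F : Fin n → Fin n → Fin n → ℝ,
          ∑ k, ∑ p, ∑ q, F k p q = ∑ k, ∑ p, ∑ q, F q p k := by
        intro F
        rw [Finset.sum_comm]
        simp only [Finset.sum_comm (γ := Fin n) (f := fun k q => F k _ q)]
        rw [Finset.sum_comm]
      rw [c]
      refine Finset.sum_congr rfl fun k _ => Finset.sum_congr rfl fun p _ =>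
        Finset.sum_congr rfl fun q _ => ?_
      rw [hT.swap_right i p k q, hT.pair j q k p, hT.swap_right j q k p]; ring
    rw [e, e']; ring
  rw [← h1]
  simp only [Finset.sum_add_distrib, Finset.sum_sub_distrib]
  linear_combination h2

lemma sum_mul_wedgeTensor_left (f : Fin n → Fin n → ℝ) (M : Mat n) (k l : Fin n) :
    ∑ p, ∑ q, f p q * wedgeTensor M 1 p q k l
      = (1 / 2) * (∑ p, f p l * M k p - ∑ p, f l p * M k p
        + ∑ p, f k p * M l p - ∑ p, f p k * M l p) := by
  have h : ∀ p q, f p q * wedgeTensor M 1 p q k l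
      = (1 / 2) * ((f p q * M k p) * (1 : Mat n) l q - (f p q * M k q) * (1 : Mat n) l p
        + (f p q * M l q) * (1 : Mat n) k p - (f p q * M l p) * (1 : Mat n) k q) := by
    intro p q; simp only [wedgeTensor]; ring
  simp only [h, ← Finset.mul_sum, Finset.sum_add_distrib, Finset.sum_sub_distrib]
  congr 1
  rw [Finset.sum_comm (f := fun p q => f p q * M k q * (1 : Mat n) l p),
    Finset.sum_comm (f := fun p q => f p q * M l q * (1 : Mat n) k p)]
  simp [Matrix.one_apply]

lemma sum_mul_wedgeTensor_cross (f : Fin n → Fin n → ℝ) {M : Mat n} (hM : ∀ i j, M j i = M i j)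
    (l j : Fin n) :
    ∑ p, ∑ q, f p q * wedgeTensor M 1 l p j q
      = (1 / 2) * (M j l * ∑ p, f p p - ∑ p, f p l * M j p
        + (1 : Mat n) j l * ∑ p, ∑ q, f p q * M p q - ∑ q, f j q * M l q) := by
  have h : ∀ p q, f p q * wedgeTensor M 1 l p j q
      = (1 / 2) * ((M j l * f p q) * (1 : Mat n) p q - (f p q * M j p) * (1 : Mat n) q l
        + (1 : Mat n) j l * (f p q * M p q) - (f p q * M l q) * (1 : Mat n) j p) := by
    intro p q
    simp only [wedgeTensor, hM p q, hM l q, Matrix.one_apply, eq_comm (a := q) (b := p)]; ring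
  simp only [h, ← Finset.mul_sum, Finset.sum_add_distrib, Finset.sum_sub_distrib]
  congr 1
  rw [Finset.sum_comm (f := fun p q => f p q * M l q * (1 : Mat n) j p)]
  simp [Matrix.one_apply, Finset.mul_sum]

lemma quadTensor_wedgeTensor (hT : IsCurvTensor T) {M : Mat n} (hM : ∀ i j, M j i = M i j)
    (i j k l : Fin n) :
    quadTensor T (wedgeTensor M 1) i j k l + quadTensor (wedgeTensor M 1) T i j k l
      = wedgeTensor (ricTensor T) M i j k l + wedgeTensor (contractTensor T M) 1 i j k l := by
  have hW := isCurvTensor_wedgeTensor hM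
    (B := 1) fun i j => by simp only [Matrix.one_apply, eq_comm]
  have z1 : ∑ p, (T i j p l * M k p - T l i j p * M k p + T l j i p * M k p) = 0 := by
    refine Finset.sum_eq_zero fun p _ => ?_
    linear_combination M k p * (-hT.bianchi l i j p + hT.swap_right i j p l
      + hT.swap_left l j i p)
  have z2 : ∑ p, (T i j k p * M l p - T k j i p * M l p + T k i j p * M l p) = 0 := by
    refine Finset.sum_eq_zero fun p _ => ?_
    linear_combination M l p * (hT.bianchi i j k p - hT.swap_left j k i p)
  have z3 : ∑ p, (T p j k l * M i p - T l p j k * M i p + T k p j l * M i p) = 0 := by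
    refine Finset.sum_eq_zero fun p _ => ?_
    linear_combination M i p * (hT.bianchi k l p j - hT.pair p j k l - hT.swap_right l p j k
      - hT.swap_left k p l j + hT.swap_right k p j l)
  have z4 : ∑ p, (T i p k l * M j p - T k p i l * M j p + T l p i k * M j p) = 0 := by
    refine Finset.sum_eq_zero fun p _ => ?_
    linear_combination M j p * (-hT.bianchi k l p i + hT.swap_right k l i p - hT.pair i p k l
      + hT.swap_right l p i k + hT.swap_left k p l i - hT.swap_right k p i l)
  simp only [Finset.sum_add_distrib, Finset.sum_sub_distrib] at z1 z2 z3 z4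
  have y1 : ∑ p, T i j l p * M k p = -∑ p, T i j p l * M k p := by
    rw [← Finset.sum_neg_distrib]
    exact Finset.sum_congr rfl fun p _ => by rw [hT.swap_right i j p l]; ring
  have y2 : ∑ p, T i j p k * M l p = -∑ p, T i j k p * M l p := by
    rw [← Finset.sum_neg_distrib]
    exact Finset.sum_congr rfl fun p _ => by rw [hT.swap_right i j k p]; ring
  have y3 : ∑ p, T j p k l * M i p = -∑ p, T p j k l * M i p := by
    rw [← Finset.sum_neg_distrib]
    exact Finset.sum_congr rfl fun p _ => by rw [hT.swap_left p j k l]; ring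
  have y4 : ∑ p, T p i k l * M j p = -∑ p, T i p k l * M j p := by
    rw [← Finset.sum_neg_distrib]
    exact Finset.sum_congr rfl fun p _ => by rw [hT.swap_left i p k l]; ring
  have t1 := sum_mul_wedgeTensor_left (T i j) M k l
  have t2 := sum_mul_wedgeTensor_cross (fun p q => T k p i q) hM l j
  have t3 := sum_mul_wedgeTensor_cross (fun p q => T k p j q) hM l i
  have t4 := sum_mul_wedgeTensor_left (fun p q => T p q k l) M i j
  simp only [hW.pair i j] at t4
  have t5 := sum_mul_wedgeTensor_cross (fun p q => T l p j q) hM k i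
  have t6 := sum_mul_wedgeTensor_cross (fun p q => T l p i q) hM k j
  have s1 : ∀ i j, ∑ p, T i p j p = ∑ p, T j p i p := fun i j =>
    Finset.sum_congr rfl fun p _ => hT.pair j p i p
  have s2 : ∀ i j, ∑ p, ∑ q, T i p j q * M p q = ∑ p, ∑ q, T j p i q * M p q := by
    intro i j
    rw [Finset.sum_comm]
    refine Finset.sum_congr rfl fun p _ => Finset.sum_congr rfl fun q _ => ?_
    rw [hT.pair j p i q, hM p q]
  simp only [mul_comm (T _ _ _ _) (wedgeTensor _ _ _ _ _ _)] at t4 t5 t6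
  rw [y1, y2] at t1
  rw [y3, y4] at t4
  simp only [quadTensor, Finset.sum_sub_distrib]
  rw [t1, t2, t3, t4, t5, t6]
  simp only [wedgeTensor, ricTensor, contractTensor, Matrix.of_apply]
  have o : ∀ i j, (1 : Mat n) j i = (1 : Mat n) i j := fun i j => by
    simp only [Matrix.one_apply, eq_comm]
  rw [hM j l, hM i k, hM j k, hM i l, o j l, o i k, o j k, o i l]
  linear_combination (1 / 2) * (z1 + z2 + z3 + z4)

end quadratic

lemma one_apply_comm (i j : Fin n) : (1 : Mat n) j i = (1 : Mat n) i j := by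
  simp only [Matrix.one_apply, eq_comm]

lemma RicM_symm {R : Module.End ℝ (so n)} (hR : isCurvOp R) (i j : Fin n) :
    RicM R j i = RicM R i j := by
  rw [isCurvOp_iff] at hR
  simp only [RicM, Matrix.of_apply]
  exact Finset.sum_congr rfl fun k _ => hR.pair i k j k

lemma Ric0_symm {R : Module.End ℝ (so n)} (hR : isCurvOp R) (i j : Fin n) :
    Ric0 R j i = Ric0 R i j := by
  simp only [Ric0, Matrix.sub_apply, Matrix.smul_apply, RicM_symm hR i j, one_apply_comm i j]

lemma RicM_add (R S : Module.End ℝ (so n)) : RicM (R + S) = RicM R + RicM S := by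
  ext i j
  simp [RicM, Rcoord_add, Finset.sum_add_distrib]

lemma RicM_smul (c : ℝ) (R : Module.End ℝ (so n)) : RicM (c • R) = c • RicM R := by
  ext i j
  simp [RicM, Rcoord_smul, Finset.mul_sum]

lemma lamb_add (R S : Module.End ℝ (so n)) : lamb (R + S) = lamb R + lamb S := by
  rw [lamb, RicM_add, Matrix.trace_add, add_div, lamb, lamb]

lemma lamb_smul (c : ℝ) (R : Module.End ℝ (so n)) : lamb (c • R) = c * lamb R := by
  rw [lamb, RicM_smul, Matrix.trace_smul, smul_eq_mul, mul_div_assoc, lamb]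

lemma RicM_eq_Ric0_add (R : Module.End ℝ (so n)) : RicM R = Ric0 R + lamb R • (1 : Mat n) := by
  simp [Ric0]

lemma trace_one_fin : Matrix.trace (1 : Mat n) = (n : ℝ) := by simp

lemma trace_RicM (hn : n ≠ 0) (R : Module.End ℝ (so n)) :
    Matrix.trace (RicM R) = n * lamb R := by
  have : (n : ℝ) ≠ 0 := Nat.cast_ne_zero.mpr hn
  rw [lamb]; field_simp

lemma trace_Ric0 (hn : n ≠ 0) (R : Module.End ℝ (so n)) : Matrix.trace (Ric0 R) = 0 := by
  rw [Ric0, Matrix.trace_sub, Matrix.trace_smul, trace_one_fin, trace_RicM hn, smul_eq_mul]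
  ring

lemma trace_Ric0_sq (hn : n ≠ 0) (R : Module.End ℝ (so n)) :
    Matrix.trace (Ric0 R * Ric0 R) = n * sigmaR R := by
  have : (n : ℝ) ≠ 0 := Nat.cast_ne_zero.mpr hn
  rw [sigmaR]; field_simp

lemma RicM_wedge {U V : Mat n} (hU : ∀ i j, U j i = U i j) (hV : ∀ i j, V j i = V i j) :
    RicM (wedge U V) = (1 / 2 : ℝ) •
      (Matrix.trace U • V + Matrix.trace V • U - U * V - V * U) := by
  ext i j
  simp only [RicM, Rcoord_wedge, wedgeTensor, Matrix.of_apply, Matrix.smul_apply,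
    Matrix.sub_apply, Matrix.add_apply, smul_eq_mul, Matrix.trace, Matrix.diag,
    Matrix.mul_apply, Finset.sum_mul, ← Finset.mul_sum, ← Finset.sum_add_distrib,
    ← Finset.sum_sub_distrib]
  congr 1
  refine Finset.sum_congr rfl fun k _ => ?_
  rw [hU i j, hV i j, hU k j, hV k j, hU i k, hV i k]
  ring

lemma contractTensor_add (T : Fin n → Fin n → Fin n → Fin n → ℝ) (M N : Mat n) :
    contractTensor T (M + N) = contractTensor T M + contractTensor T N := by
  ext i j
  simp [contractTensor, mul_add, Finset.sum_add_distrib]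

lemma contractTensor_smul (T : Fin n → Fin n → Fin n → Fin n → ℝ) (c : ℝ) (M : Mat n) :
    contractTensor T (c • M) = c • contractTensor T M := by
  ext i j
  simp [contractTensor, Finset.mul_sum, mul_left_comm]

lemma contractTensor_one (T : Fin n → Fin n → Fin n → Fin n → ℝ) :
    contractTensor T 1 = ricTensor T := by
  ext i j
  simp [contractTensor, ricTensor, Matrix.one_apply]

lemma contractTensor_wedgeTensor {M : Mat n} (hM : ∀ i j, M j i = M i j) :
    contractTensor (wedgeTensor M 1) M = (1 / 2 : ℝ) •
      (Matrix.trace M • M - (2 : ℝ) • (M * M) + Matrix.trace (M * M) • (1 : Mat n)) := by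
  ext i j
  have h := sum_mul_wedgeTensor_cross (fun p q => M p q) hM i j
  simp only [contractTensor, Matrix.of_apply, mul_comm (wedgeTensor _ _ _ _ _ _)]
  rw [h]
  simp only [Matrix.smul_apply, Matrix.sub_apply, Matrix.add_apply, smul_eq_mul, Matrix.trace,
    Matrix.diag, Matrix.mul_apply]
  have e1 : ∑ p, M p i * M j p = ∑ p, M i p * M p j :=
    Finset.sum_congr rfl fun p _ => by rw [hM i p, hM j p]
  have e2 : ∑ p, M j p * M i p = ∑ p, M i p * M p j :=
    Finset.sum_congr rfl fun p _ => by rw [hM j p]; ring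
  have e3 : ∑ p, ∑ q, M p q * M p q = ∑ p, ∑ q, M p q * M q p :=
    Finset.sum_congr rfl fun p _ => Finset.sum_congr rfl fun q _ => by rw [hM p q]
  rw [e1, e2, e3, hM i j, one_apply_comm i j]
  ring

lemma quadTensor_add (T U : Fin n → Fin n → Fin n → Fin n → ℝ) (i j k l : Fin n) :
    quadTensor (T + U) (T + U) i j k l
      = quadTensor T T i j k l + (quadTensor T U i j k l + quadTensor U T i j k l)
        + quadTensor U U i j k l := by
  simp only [quadTensor, Pi.add_apply, Finset.mul_sum, ← Finset.sum_add_distrib]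
  refine Finset.sum_congr rfl fun p _ => Finset.sum_congr rfl fun q _ => ?_
  ring

lemma isCurvOp_Qode {R : Module.End ℝ (so n)} (hR : isCurvOp R) : isCurvOp (Qode R) := by
  have h : Rcoord (Qode R) = quadTensor (Rcoord R) (Rcoord R) := by
    funext i j k l; exact Rcoord_Qode hR.1 i j k l
  rw [isCurvOp_iff, h]
  exact isCurvTensor_quadTensor ((isCurvOp_iff R).1 hR)

lemma RicM_Qode {R : Module.End ℝ (so n)} (hR : isCurvOp R) :
    RicM (Qode R) = contractTensor (Rcoord R) (RicM R) := by
  have h : Rcoord (Qode R) = quadTensor (Rcoord R) (Rcoord R) := by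
    funext i j k l; exact Rcoord_Qode hR.1 i j k l
  rw [RicM_eq_ricTensor, h, ricTensor_quadTensor ((isCurvOp_iff R).1 hR), RicM_eq_ricTensor]

lemma Rcoord_Qode_add_wedge {R : Module.End ℝ (so n)} (hR : isCurvOp R) {M : Mat n}
    (hM : ∀ i j, M j i = M i j) (i j k l : Fin n) :
    Rcoord (Qode (R + wedge M 1)) i j k l
      = Rcoord (Qode R) i j k l + wedgeTensor (RicM R) M i j k l
        + wedgeTensor (contractTensor (Rcoord R) M) 1 i j k l
        + (1 / 2) * (wedgeTensor (RicM (wedge M 1)) M i j k l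
          + wedgeTensor (contractTensor (wedgeTensor M 1) M) 1 i j k l) := by
  have hW : Rcoord (wedge M 1) = wedgeTensor M 1 := by
    funext i j k l; exact Rcoord_wedge M 1 i j k l
  have hRW : Rcoord (R + wedge M 1) = Rcoord R + wedgeTensor M 1 := by
    funext i j k l
    rw [Rcoord_add, Rcoord_wedge]; rfl
  have hcW := isCurvOp_wedge hM one_apply_comm
  have hU := quadTensor_wedgeTensor (isCurvTensor_wedgeTensor hM one_apply_comm) hM i j k l
  rw [Rcoord_Qode (isCurvOp_add hR hcW).1, Rcoord_Qode hR.1, hRW, quadTensor_add,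
    quadTensor_wedgeTensor ((isCurvOp_iff R).1 hR) hM, RicM_eq_ricTensor, RicM_eq_ricTensor, hW]
  linear_combination (1 / 2) * hU

lemma trace_contractTensor {R : Module.End ℝ (so n)} (hR : isCurvOp R) :
    Matrix.trace (contractTensor (Rcoord R) (RicM R)) = Matrix.trace (RicM R * RicM R) := by
  have hT := (isCurvOp_iff R).1 hR
  simp only [Matrix.trace, Matrix.diag, contractTensor, Matrix.of_apply, Matrix.mul_apply]
  rw [Finset.sum_comm]
  refine Finset.sum_congr rfl fun k _ => ?_
  rw [Finset.sum_comm]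
  refine Finset.sum_congr rfl fun l _ => ?_
  rw [← Finset.sum_mul, RicM_symm hR k l]
  congr 1
  refine Finset.sum_congr rfl fun i _ => ?_
  rw [hT.swap_left k i i l, hT.swap_right k i l i]; ring

lemma lamb_Qode (hn : n ≠ 0) {R : Module.End ℝ (so n)} (hR : isCurvOp R) :
    lamb (Qode R) = sigmaR R + lamb R ^ 2 := by
  have h0 : (n : ℝ) ≠ 0 := Nat.cast_ne_zero.mpr hn
  have h1 : RicM R * RicM R
      = Ric0 R * Ric0 R + (2 * lamb R) • Ric0 R + (lamb R ^ 2) • (1 : Mat n) := by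
    rw [RicM_eq_Ric0_add]
    simp only [mul_add, add_mul, Matrix.mul_smul, Matrix.smul_mul, mul_one, one_mul]
    module
  rw [lamb, RicM_Qode hR, trace_contractTensor hR, h1, Matrix.trace_add, Matrix.trace_add,
    Matrix.trace_smul, Matrix.trace_smul, trace_Ric0 hn, trace_Ric0_sq hn, trace_one_fin]
  simp only [smul_eq_mul]
  field_simp
  ring

lemma Rcoord_lab (hn : 3 ≤ n) (a b : ℝ) (R : Module.End ℝ (so n)) (i j k l : Fin n) :
    Rcoord (lab a b R) i j k l = Rcoord R i j k l
      + wedgeTensor ((2 * b) • Ric0 R + (2 * a * lamb R) • (1 : Mat n)) 1 i j k l := by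
  have hn' : (3 : ℝ) ≤ n := by exact_mod_cast hn
  have h1 : (n : ℝ) - 1 ≠ 0 := by linarith
  have h2 : (n : ℝ) - 2 ≠ 0 := by linarith
  simp only [lab, RI, RRic0, Rcoord_add, Rcoord_smul, Rcoord_wedge, wedgeTensor,
    Matrix.add_apply, Matrix.smul_apply, smul_eq_mul]
  field_simp
  ring

lemma lab_eq (hn : 3 ≤ n) (a b : ℝ) (R : Module.End ℝ (so n)) :
    lab a b R = R + wedge ((2 * b) • Ric0 R + (2 * a * lamb R) • (1 : Mat n)) 1 :=
  end_ext_Rcoord fun i j k l => by rw [Rcoord_lab hn, Rcoord_add, Rcoord_wedge]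

/-- The constant multiplying `id ∧ id` in the difference `D_{a,b}`. -/
def kap (n : ℕ) (a b : ℝ) : ℝ :=
  (n * b ^ 2 * (1 - 2 * b) - 2 * (a - b) * (1 - 2 * b + n * b ^ 2)) / (1 + 2 * (n - 1) * a)

/-- The difference `ℓ⁻¹(ℓ(R)² + ℓ(R)^#) - (R² + R^#)` for `ℓ = ℓ_{a,b}`. -/
def Dab (a b : ℝ) (R : Module.End ℝ (so n)) : Module.End ℝ (so n) :=
  (((n : ℝ) - 2) * b ^ 2 + 2 * b) • wedge (Ric0 R) (Ric0 R)
    + (4 * a * lamb R) • wedge (Ric0 R) 1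
    + (2 * b ^ 2) • wedge (Ric0 R * Ric0 R) 1
    + (2 * a * lamb R ^ 2 + kap n a b * sigmaR R) • wedge 1 1

lemma mul_self_symm {N : Mat n} (hN : ∀ i j, N j i = N i j) (i j : Fin n) :
    (N * N) j i = (N * N) i j := by
  simp only [Matrix.mul_apply]
  refine Finset.sum_congr rfl fun k _ => ?_
  rw [hN k j, hN i k]; ring

lemma isCurvOp_Dab (a b : ℝ) {R : Module.End ℝ (so n)} (hR : isCurvOp R) :
    isCurvOp (Dab a b R) := by
  have hN := Ric0_symm hR
  exact isCurvOp_add (isCurvOp_add (isCurvOp_add (isCurvOp_smul _ (isCurvOp_wedge hN hN))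
    (isCurvOp_smul _ (isCurvOp_wedge hN one_apply_comm)))
    (isCurvOp_smul _ (isCurvOp_wedge (mul_self_symm hN) one_apply_comm)))
    (isCurvOp_smul _ (isCurvOp_wedge one_apply_comm one_apply_comm))

lemma isCurvOp_lab (hn : 3 ≤ n) (a b : ℝ) {R : Module.End ℝ (so n)} (hR : isCurvOp R) :
    isCurvOp (lab a b R) := by
  rw [lab_eq hn]
  refine isCurvOp_add hR (isCurvOp_wedge (fun i j => ?_) one_apply_comm)
  simp only [Matrix.add_apply, Matrix.smul_apply, Ric0_symm hR i j, one_apply_comm i j]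

lemma RicM_Dab (hn : n ≠ 0) (a b : ℝ) {R : Module.End ℝ (so n)} (hR : isCurvOp R) :
    RicM (Dab a b R) = (-2 * b) • (Ric0 R * Ric0 R) + (2 * a * lamb R * (n - 2)) • Ric0 R
      + (b ^ 2 * n * sigmaR R
        + (n - 1) * (2 * a * lamb R ^ 2 + kap n a b * sigmaR R)) • (1 : Mat n) := by
  have hN := Ric0_symm hR
  rw [Dab]
  simp only [RicM_add, RicM_smul, RicM_wedge hN hN, RicM_wedge hN one_apply_comm,
    RicM_wedge (mul_self_symm hN) one_apply_comm, RicM_wedge (U := 1) (V := 1) one_apply_comm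
    one_apply_comm, trace_Ric0 hn, trace_Ric0_sq hn, trace_one_fin, mul_one, one_mul]
  module

lemma lamb_Dab (hn : n ≠ 0) (a b : ℝ) {R : Module.End ℝ (so n)} (hR : isCurvOp R) :
    lamb (Dab a b R) = -2 * b * sigmaR R + b ^ 2 * n * sigmaR R
        + (n - 1) * (2 * a * lamb R ^ 2 + kap n a b * sigmaR R) := by
  have h0 : (n : ℝ) ≠ 0 := Nat.cast_ne_zero.mpr hn
  rw [lamb, RicM_Dab hn a b hR]
  simp only [Matrix.trace_add, Matrix.trace_smul, trace_Ric0 hn, trace_Ric0_sq hn, trace_one_fin,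
    smul_eq_mul]
  field_simp
  ring

theorem lab_Qode_add_Dab (hn : 3 ≤ n) (a b : ℝ) (ha : 1 + 2 * ((n : ℝ) - 1) * a ≠ 0)
    {R : Module.End ℝ (so n)} (hR : isCurvOp R) :
    lab a b (Qode R + Dab a b R) = Qode (lab a b R) := by
  have hn0 : n ≠ 0 := by omega
  have hN := Ric0_symm hR
  set N := Ric0 R with hNdef
  set lam := lamb R with hlam
  set sig := sigmaR R with hsig
  set K := RicM (Qode R) with hK
  set M : Mat n := (2 * b) • N + (2 * a * lam) • (1 : Mat n) with hMdef
  have hM : ∀ i j, M j i = M i j := fun i j => by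
    simp only [hMdef, Matrix.add_apply, Matrix.smul_apply, hN i j, one_apply_comm i j]
  have hkap : kap n a b * (1 + 2 * ((n : ℝ) - 1) * a)
      = n * b ^ 2 * (1 - 2 * b) - 2 * (a - b) * (1 - 2 * b + n * b ^ 2) := by
    rw [kap, div_mul_cancel₀ _ ha]
  have hRic : RicM R = N + lam • (1 : Mat n) := RicM_eq_Ric0_add R
  have hcR : contractTensor (Rcoord R) M
      = (2 * b) • K + (2 * a * lam - 2 * b * lam) • (N + lam • (1 : Mat n)) := by
    have h1 : M = (2 * b) • RicM R + (2 * a * lam - 2 * b * lam) • (1 : Mat n) := by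
      rw [hRic, hMdef]; module
    rw [h1, contractTensor_add, contractTensor_smul, contractTensor_smul, contractTensor_one,
      ← RicM_Qode hR, ← RicM_eq_ricTensor, hRic]
  have htM : Matrix.trace M = 2 * a * lam * n := by
    simp only [hMdef, Matrix.trace_add, Matrix.trace_smul, hNdef, trace_Ric0 hn0, trace_one_fin,
      smul_eq_mul]
    ring
  have hMM : M * M = (4 * b ^ 2) • (N * N) + (8 * a * b * lam) • N
      + (4 * a ^ 2 * lam ^ 2) • (1 : Mat n) := by
    simp only [hMdef, mul_add, add_mul, Matrix.mul_smul, Matrix.smul_mul, mul_one, one_mul]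
    module
  have htMM : Matrix.trace (M * M) = n * (4 * b ^ 2 * sig + 4 * a ^ 2 * lam ^ 2) := by
    rw [hMM]
    simp only [Matrix.trace_add, Matrix.trace_smul, hNdef, trace_Ric0 hn0, trace_Ric0_sq hn0,
      trace_one_fin, smul_eq_mul]
    ring
  have hKD : RicM (Qode R + Dab a b R) = K + RicM (Dab a b R) := RicM_add _ _
  have hl : lamb (Qode R + Dab a b R) = sig + lam ^ 2 + lamb (Dab a b R) := by
    rw [lamb_add, lamb_Qode hn0 hR]
  refine end_ext_Rcoord fun i j k l => ?_
  rw [Rcoord_lab hn, lab_eq hn a b R, Rcoord_Qode_add_wedge hR hM, hcR,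
    contractTensor_wedgeTensor hM, RicM_wedge hM one_apply_comm, htM, htMM, hMM, Ric0, hKD, hl,
    hRic, RicM_Dab hn0 a b hR, lamb_Dab hn0 a b hR, Rcoord_add]
  simp only [Dab, Rcoord_add, Rcoord_smul, Rcoord_wedge, wedgeTensor, hMdef, mul_one, one_mul,
    Matrix.add_apply, Matrix.sub_apply, Matrix.smul_apply, smul_eq_mul, trace_one_fin,
    ← hNdef, ← hlam, ← hsig]
  linear_combination sig * ((1 : Mat n) k i * (1 : Mat n) l j - (1 : Mat n) k j * (1 : Mat n) l i)
    * hkap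

lemma ip_add_left (X Y Z : so n) : ip (X + Y) Z = ip X Z + ip Y Z := by
  rw [ip_comm, ip_comm X, ip_comm Y]; exact (ipL Z).map_add X Y

lemma ip_smul_left (c : ℝ) (X Z : so n) : ip (c • X) Z = c * ip X Z := by
  rw [ip_comm, ip_comm X]; exact (ipL Z).map_smul c X

lemma exists_factor_of_posSemidefEnd {R : Module.End ℝ (so n)} (hR : selfAdjEnd R)
    (hpos : posSemidefEnd R) :
    ∃ (m : ℕ) (B : Fin m → Fin n → Fin n → ℝ),
      ∀ i j k l, Rcoord R i j k l = ∑ α, B α i j * B α k l := by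
  have hpsd : (Matrix.of fun x y : Fin n × Fin n => Rcoord R x.1 x.2 y.1 y.2).PosSemidef := by
    refine Matrix.PosSemidef.of_dotProduct_mulVec_nonneg ?_ fun x => ?_
    · ext x y
      simp only [Matrix.conjTranspose_apply, Matrix.of_apply, star_trivial]
      exact (selfAdjEnd_iff R).1 hR _ _ _ _
    · have h := hpos (∑ y : Fin n × Fin n, x y • bvec y.1 y.2)
      have e : ip (R (∑ y : Fin n × Fin n, x y • bvec y.1 y.2))
          (∑ y : Fin n × Fin n, x y • bvec y.1 y.2)
          = star x ⬝ᵥ ((Matrix.of fun x y : Fin n × Fin n => Rcoord R x.1 x.2 y.1 y.2) *ᵥ x) := by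
        have e1 : ∀ Z : so n, ip Z (∑ y : Fin n × Fin n, x y • bvec y.1 y.2)
            = ∑ y : Fin n × Fin n, x y * ip Z (bvec y.1 y.2) := by
          intro Z
          change ipL Z _ = _
          rw [map_sum]
          simp only [map_smul, smul_eq_mul]
          rfl
        rw [e1]
        simp only [dotProduct, Matrix.mulVec, Matrix.of_apply, star_trivial]
        refine Finset.sum_congr rfl fun y _ => ?_
        rw [hR, ip_comm, e1]
        simp only [Rcoord, mul_comm]
      rw [← e]; exact h
  obtain ⟨m, v, hv⟩ := Matrix.posSemidef_iff_eq_sum_vecMulVec.1 hpsd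
  refine ⟨m, fun α i j => v α (i, j), fun i j k l => ?_⟩
  have h := congrFun (congrFun hv (i, j)) (k, l)
  simpa [Matrix.sum_apply, Matrix.vecMulVec_apply] using h

lemma exists_factor_of_posSemidef {P : Mat n} (hP : P.PosSemidef) :
    ∃ (m : ℕ) (C : Fin m → Fin n → ℝ), ∀ k l, P k l = ∑ α, C α k * C α l := by
  obtain ⟨m, v, hv⟩ := Matrix.posSemidef_iff_eq_sum_vecMulVec.1 hP
  refine ⟨m, v, fun k l => ?_⟩
  rw [hv]
  simp [Matrix.sum_apply, Matrix.vecMulVec_apply]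

lemma sum_mul_factor_nonneg {ι α β : Type*} [Fintype ι] [Fintype α] [Fintype β]
    (g : α → β → ι → ℝ) (F : ι → ι → ℝ) (hF : ∀ s t, F s t = ∑ x, ∑ y, g x y s * g x y t) :
    0 ≤ ∑ s, ∑ t, F s t := by
  have h : ∑ s, ∑ t, F s t = ∑ x, ∑ y, (∑ s, g x y s) * ∑ t, g x y t := by
    have h1 : ∀ s, ∑ t, F s t = ∑ x, ∑ y, g x y s * ∑ t, g x y t := by
      intro s
      simp only [hF]
      rw [Finset.sum_comm]
      refine Finset.sum_congr rfl fun x _ => ?_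
      rw [Finset.sum_comm]
      exact Finset.sum_congr rfl fun y _ => (Finset.mul_sum _ _ _).symm
    simp only [h1]
    rw [Finset.sum_comm]
    refine Finset.sum_congr rfl fun x _ => ?_
    rw [Finset.sum_comm]
    exact Finset.sum_congr rfl fun y _ => (Finset.sum_mul _ _ _).symm
  rw [h]
  exact Finset.sum_nonneg fun x _ => Finset.sum_nonneg fun y _ => mul_self_nonneg _

lemma sharp_nonneg {R : Module.End ℝ (so n)} (hR : selfAdjEnd R) (hpos : posSemidefEnd R) :
    posSemidefEnd (sharp R R) := by
  intro X
  obtain ⟨m, B, hB⟩ := exists_factor_of_posSemidefEnd hR hpos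
  have h := sum_mul_factor_nonneg (ι := Fin n × Fin n × Fin n)
    (fun (α β : Fin m) t => (X : Mat n) t.1 t.2.1 * B α t.1 t.2.2 * B β t.2.1 t.2.2)
    (fun s t => (X : Mat n) s.1 s.2.1 * (X : Mat n) t.1 t.2.1 * Rcoord R s.1 s.2.2 t.1 t.2.2
      * Rcoord R s.2.1 s.2.2 t.2.1 t.2.2) (by
      intro s t
      rw [hB, hB, mul_assoc, Finset.sum_mul_sum, Finset.mul_sum]
      refine Finset.sum_congr rfl fun α _ => ?_
      rw [Finset.mul_sum]
      exact Finset.sum_congr rfl fun β _ => by ring)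
  have e1 : ∀ k l, ∑ i, ∑ j, (X : Mat n) i j * Rcoord (sharp R R) i j k l * (X : Mat n) k l
      = 2 * ∑ i, ∑ j, ∑ p, ∑ q, (X : Mat n) k l * (X : Mat n) i j * Rcoord R k p i q
        * Rcoord R l p j q := by
    intro k l
    have e2 : ∑ i, ∑ j, ∑ p, ∑ q, (X : Mat n) k l * (X : Mat n) i j * Rcoord R k p j q
        * Rcoord R l p i q = -∑ i, ∑ j, ∑ p, ∑ q, (X : Mat n) k l * (X : Mat n) i j
        * Rcoord R k p i q * Rcoord R l p j q := by
      rw [Finset.sum_comm]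
      simp only [← Finset.sum_neg_distrib]
      refine Finset.sum_congr rfl fun i _ => Finset.sum_congr rfl fun j _ =>
        Finset.sum_congr rfl fun p _ => Finset.sum_congr rfl fun q _ => ?_
      rw [so_apply_swap X i j]; ring
    have e3 : ∀ i j, (X : Mat n) i j * Rcoord (sharp R R) i j k l * (X : Mat n) k l
        = ∑ p, ∑ q, (X : Mat n) k l * (X : Mat n) i j * Rcoord R k p i q * Rcoord R l p j q
          - ∑ p, ∑ q, (X : Mat n) k l * (X : Mat n) i j * Rcoord R k p j q
            * Rcoord R l p i q := by
      intro i j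
      rw [Rcoord_sharp R hR]
      simp only [Finset.mul_sum, Finset.sum_mul, ← Finset.sum_sub_distrib]
      exact Finset.sum_congr rfl fun p _ => Finset.sum_congr rfl fun q _ => by ring
    simp only [e3, Finset.sum_sub_distrib, e2]
    ring
  rw [ip_apply_eq_sum]
  simp only [e1, ← Finset.mul_sum]
  refine mul_nonneg (by norm_num) (mul_nonneg zero_le_two ?_)
  refine h.trans_eq (Eq.symm ?_)
  simp only [Fintype.sum_prod_type]
  refine Finset.sum_congr rfl fun k _ => Finset.sum_congr rfl fun l _ => ?_
  conv_rhs => rw [Finset.sum_comm]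
  refine Finset.sum_congr rfl fun i _ => ?_
  rw [Finset.sum_comm]

lemma contractTensor_nonneg {R : Module.End ℝ (so n)} (hR : selfAdjEnd R)
    (hpos : posSemidefEnd R) {P : Mat n} (hP : P.PosSemidef) (v : Fin n → ℝ) :
    0 ≤ v ⬝ᵥ (contractTensor (Rcoord R) P *ᵥ v) := by
  obtain ⟨m, B, hB⟩ := exists_factor_of_posSemidefEnd hR hpos
  obtain ⟨m', C, hC⟩ := exists_factor_of_posSemidef hP
  have h := sum_mul_factor_nonneg (ι := Fin n × Fin n)
    (fun (α : Fin m) (β : Fin m') t => v t.1 * B α t.1 t.2 * C β t.2)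
    (fun s t => v s.1 * v t.1 * Rcoord R s.1 s.2 t.1 t.2 * P s.2 t.2) (by
      intro s t
      rw [hB, hC, mul_assoc, Finset.sum_mul_sum, Finset.mul_sum]
      refine Finset.sum_congr rfl fun α _ => ?_
      rw [Finset.mul_sum]
      exact Finset.sum_congr rfl fun β _ => by ring)
  have e : v ⬝ᵥ (contractTensor (Rcoord R) P *ᵥ v) = ∑ s : Fin n × Fin n, ∑ t : Fin n × Fin n,
      v s.1 * v t.1 * Rcoord R s.1 s.2 t.1 t.2 * P s.2 t.2 := by
    simp only [dotProduct, Matrix.mulVec, contractTensor, Matrix.of_apply, Fintype.sum_prod_type,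
      Finset.mul_sum, Finset.sum_mul]
    refine Finset.sum_congr rfl fun i _ => ?_
    rw [Finset.sum_comm]
    refine Finset.sum_congr rfl fun k _ => Finset.sum_congr rfl fun j _ =>
      Finset.sum_congr rfl fun l _ => ?_
    ring
  rw [e]; exact h

lemma mul_self_nonneg_end {R : Module.End ℝ (so n)} (hR : selfAdjEnd R) :
    posSemidefEnd (R * R) := by
  intro X
  rw [Module.End.mul_apply, hR]
  exact ip_self_nonneg _

lemma Qode_nonneg {R : Module.End ℝ (so n)} (hR : selfAdjEnd R) (hpos : posSemidefEnd R) :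
    posSemidefEnd (Qode R) := by
  intro X
  rw [Qode, LinearMap.add_apply, ip_add_left]
  exact add_nonneg (mul_self_nonneg_end hR X) (sharp_nonneg hR hpos X)

lemma wedge_self_nonneg {P : Mat n} (hP : P.PosSemidef) : posSemidefEnd (wedge P P) := by
  intro X
  obtain ⟨m, C, hC⟩ := exists_factor_of_posSemidef hP
  have h := sum_mul_factor_nonneg (ι := Fin n × Fin n)
    (fun (α β : Fin m) t => (X : Mat n) t.1 t.2 * C α t.1 * C β t.2)
    (fun s t => (X : Mat n) s.1 s.2 * (X : Mat n) t.1 t.2 * P s.1 t.1 * P s.2 t.2) (by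
      intro s t
      rw [hC, hC, mul_assoc, Finset.sum_mul_sum, Finset.mul_sum]
      refine Finset.sum_congr rfl fun α _ => ?_
      rw [Finset.mul_sum]
      exact Finset.sum_congr rfl fun β _ => by ring)
  have e : ip (wedge P P X) X = (1 / 2) * ∑ s : Fin n × Fin n, ∑ t : Fin n × Fin n,
      (X : Mat n) s.1 s.2 * (X : Mat n) t.1 t.2 * P s.1 t.1 * P s.2 t.2 := by
    have e1 : ∀ k l, (wedge P P X : Mat n) k l = ∑ i, ∑ j, P k i * (X : Mat n) i j * P l j := by
      intro k l
      change ((1 / 2 : ℝ) • (P * (X : Mat n) * Pᵀ + P * (X : Mat n) * Pᵀ)) k l = _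
      rw [Matrix.smul_apply, Matrix.add_apply, smul_eq_mul]
      simp only [Matrix.mul_apply, Matrix.transpose_apply, Finset.sum_mul]
      rw [Finset.sum_comm]; ring
    rw [ip_eq_sum]
    simp only [e1, Fintype.sum_prod_type, Finset.sum_mul]
    congr 1
    refine Finset.sum_congr rfl fun k _ => Finset.sum_congr rfl fun l _ =>
      Finset.sum_congr rfl fun i _ => Finset.sum_congr rfl fun j _ => ?_
    ring
  rw [e]; linarith

lemma wedge_sq_one_nonneg {N : Mat n} (hN : ∀ i j, N j i = N i j) :
    posSemidefEnd (wedge (N * N) 1) := by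
  intro X
  have hNt : Nᵀ = N := by ext i j; exact hN i j
  have hX : (X : Mat n)ᵀ = -(X : Mat n) := X.2
  have e : ip (wedge (N * N) 1 X) X
      = (1 / 2) * Matrix.trace ((N * (X : Mat n)) * (N * (X : Mat n))ᵀ) := by
    have e1 : (wedge (N * N) 1 X : Mat n)
        = (1 / 2 : ℝ) • (N * N * (X : Mat n) + (X : Mat n) * (N * N)) := by
      change (1 / 2 : ℝ) • ((N * N) * (X : Mat n) * (1 : Mat n)ᵀ
        + 1 * (X : Mat n) * (N * N)ᵀ) = _
      simp only [Matrix.transpose_one, Matrix.transpose_mul, hNt, mul_one, one_mul]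
    have t1 : Matrix.trace (N * N * (X : Mat n) * (X : Mat n))
        = Matrix.trace (N * (X : Mat n) * ((X : Mat n) * N)) := by
      rw [Matrix.mul_assoc, Matrix.mul_assoc, Matrix.trace_mul_comm]
      simp only [Matrix.mul_assoc]
    have t2 : Matrix.trace ((X : Mat n) * (N * N) * (X : Mat n))
        = Matrix.trace (N * (X : Mat n) * ((X : Mat n) * N)) := by
      rw [← Matrix.mul_assoc, Matrix.mul_assoc, Matrix.trace_mul_comm]
    rw [ip, e1, Matrix.transpose_mul, hNt, hX, Matrix.smul_mul, Matrix.trace_smul, add_mul,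
      Matrix.trace_add, t1, t2, Matrix.neg_mul, Matrix.mul_neg, Matrix.trace_neg, smul_eq_mul]
    ring
  rw [e, Matrix.trace]
  refine mul_nonneg (by norm_num) (Finset.sum_nonneg fun i _ => ?_)
  simp only [Matrix.diag, Matrix.mul_apply (M := N * (X : Mat n)), Matrix.transpose_apply]
  exact Finset.sum_nonneg fun j _ => mul_self_nonneg _

lemma wedge_one_one (X : so n) : wedge 1 1 X = X := by
  ext i j
  change ((1 / 2 : ℝ) • ((1 : Mat n) * (X : Mat n) * (1 : Mat n)ᵀ
    + (1 : Mat n) * (X : Mat n) * (1 : Mat n)ᵀ)) i j = _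
  simp only [Matrix.transpose_one, mul_one, one_mul, Matrix.smul_apply, Matrix.add_apply,
    smul_eq_mul]
  ring

lemma dotProduct_mul_self_le {P : Mat n} (hP : P.PosSemidef) (v : Fin n → ℝ) :
    v ⬝ᵥ ((P * P) *ᵥ v) ≤ Matrix.trace P * (v ⬝ᵥ (P *ᵥ v)) := by
  obtain ⟨m, C, hC⟩ := exists_factor_of_posSemidef hP
  have hPv : ∀ i, (P *ᵥ v) i = ∑ β, C β i * ∑ l, C β l * v l := by
    intro i
    simp only [Matrix.mulVec, dotProduct, hC, Finset.sum_mul, Finset.mul_sum]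
    rw [Finset.sum_comm]
    exact Finset.sum_congr rfl fun β _ => Finset.sum_congr rfl fun l _ => by ring
  have h1 : v ⬝ᵥ ((P * P) *ᵥ v) = ∑ i, (P *ᵥ v) i ^ 2 := by
    have hPt : Pᵀ = P := by
      ext i j; simp only [Matrix.transpose_apply, hC, mul_comm]
    rw [← Matrix.mulVec_mulVec, Matrix.dotProduct_mulVec, ← Matrix.mulVec_transpose, hPt]
    simp only [dotProduct, sq]
  have h2 : v ⬝ᵥ (P *ᵥ v) = ∑ β, (∑ l, C β l * v l) ^ 2 := by
    simp only [dotProduct, hPv, Finset.mul_sum]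
    rw [Finset.sum_comm]
    refine Finset.sum_congr rfl fun β _ => ?_
    rw [sq, Finset.sum_mul_sum]
    exact Finset.sum_congr rfl fun i _ => Finset.sum_congr rfl fun l _ => by ring
  have h3 : Matrix.trace P = ∑ i, ∑ β, C β i ^ 2 := by
    simp only [Matrix.trace, Matrix.diag, hC, sq]
  rw [h1, h2, h3, Finset.sum_mul]
  refine Finset.sum_le_sum fun i _ => ?_
  rw [hPv]
  exact Finset.sum_mul_sq_le_sq_mul_sq _ _ _

lemma trace_RicM_eq (R : Module.End ℝ (so n)) :
    Matrix.trace (RicM R) = ∑ i, ∑ k, Rcoord R i k i k := rfl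

lemma lamb_pos (hn : n ≠ 0) {R : Module.End ℝ (so n)} (hR : selfAdjEnd R)
    (hpos : posSemidefEnd R) (h0 : R ≠ 0) : 0 < lamb R := by
  obtain ⟨m, B, hB⟩ := exists_factor_of_posSemidefEnd hR hpos
  have hnn : ∀ i k, 0 ≤ Rcoord R i k i k := fun i k => hpos _
  have htr : 0 ≤ Matrix.trace (RicM R) := by
    rw [trace_RicM_eq]
    exact Finset.sum_nonneg fun i _ => Finset.sum_nonneg fun k _ => hnn i k
  have hn' : (0 : ℝ) < n := by exact_mod_cast Nat.pos_of_ne_zero hn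
  refine div_pos (lt_of_le_of_ne htr fun hz => h0 ?_) hn'
  rw [trace_RicM_eq] at hz
  have hd : ∀ i k, Rcoord R i k i k = 0 := by
    intro i k
    have h1 := (Finset.sum_eq_zero_iff_of_nonneg
      (fun i _ => Finset.sum_nonneg fun k _ => hnn i k)).1 hz.symm i (Finset.mem_univ _)
    exact (Finset.sum_eq_zero_iff_of_nonneg (fun k _ => hnn i k)).1 h1 k (Finset.mem_univ _)
  have hB0 : ∀ α i k, B α i k = 0 := by
    intro α i k
    have h1 := hd i k
    rw [hB] at h1
    exact mul_self_eq_zero.1 ((Finset.sum_eq_zero_iff_of_nonneg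
      (fun α _ => mul_self_nonneg _)).1 h1 α (Finset.mem_univ _))
  refine end_ext_Rcoord fun i j k l => ?_
  rw [hB]
  simp [hB0, Rcoord_eq]

/-- The numerical relations between the parameters `a`, `b`, `p`, `κ`. -/
lemma param_relations (hn : 3 ≤ n) {a b p : ℝ} (hb : b ∈ Set.Ioc (0 : ℝ) (1 / 2))
    (ha : a = (((n : ℝ) - 2) * b ^ 2 + 2 * b) / (2 + 2 * ((n : ℝ) - 2) * b ^ 2))
    (hp : p = ((n : ℝ) - 2) * b ^ 2 / (1 + ((n : ℝ) - 2) * b ^ 2)) :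
    0 < a ∧ 0 < p ∧ p < 1 ∧ (((n : ℝ) - 2) * b ^ 2 + 2 * b) * (1 - p) = 2 * a ∧
      2 * a = p + 2 * b * (1 - p) ∧ 0 ≤ kap n a b ∧
      0 < (1 - p) * (b ^ 2 * n + (n - 1) * kap n a b) - p + 2 * b * p := by
  obtain ⟨hb0, hb1⟩ := hb
  have hn' : (3 : ℝ) ≤ n := by exact_mod_cast hn
  have hm : 0 < (n : ℝ) - 2 := by linarith
  have hb2 : 0 < b ^ 2 := by positivity
  have hmb : 0 < ((n : ℝ) - 2) * b ^ 2 := by positivity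
  have hd : 0 < 1 + ((n : ℝ) - 2) * b ^ 2 := by positivity
  have hp0 : 0 < p := by rw [hp]; positivity
  have hs : 1 - p = 1 / (1 + ((n : ℝ) - 2) * b ^ 2) := by rw [hp]; field_simp; ring
  have hs0 : 0 < 1 - p := by rw [hs]; positivity
  have hps : p = ((n : ℝ) - 2) * b ^ 2 * (1 - p) := by rw [hs, hp]; ring
  have ha2 : (((n : ℝ) - 2) * b ^ 2 + 2 * b) * (1 - p) = 2 * a := by
    rw [hs, ha]
    have : (2 + 2 * ((n : ℝ) - 2) * b ^ 2) = 2 * (1 + ((n : ℝ) - 2) * b ^ 2) := by ring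
    rw [this]; field_simp
  have ha0 : 0 < a := by
    have : 0 < (((n : ℝ) - 2) * b ^ 2 + 2 * b) * (1 - p) := by positivity
    linarith
  have ha3 : 2 * a = p + 2 * b * (1 - p) := by rw [← ha2]; linarith
  have hw : 0 ≤ 1 - 2 * b := by linarith
  have hk : kap n a b = (1 - 2 * b) * b ^ 2 * (1 - p) * (2 + 2 * b * (n - 2))
      / (1 + 2 * (n - 1) * a) := by
    rw [kap]
    congr 1
    have h1 : 2 * (a - b) = p * (1 - 2 * b) := by linarith
    rw [h1]
    linear_combination (-(1 - 2 * b) ^ 2) * hps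
  have hk0 : 0 ≤ kap n a b := by
    rw [hk]
    have : 0 < (n : ℝ) - 1 := by linarith
    positivity
  refine ⟨ha0, hp0, by linarith, ha2, ha3, hk0, ?_⟩
  have hg : (1 - p) * (b ^ 2 * n + (n - 1) * kap n a b) - p + 2 * b * p
      = (1 - p) * b ^ 2 * (2 + 2 * b * (n - 2)) + (1 - p) * (n - 1) * kap n a b := by
    linear_combination (-(1 - 2 * b)) * hps
  rw [hg]
  have : 0 < (n : ℝ) - 1 := by linarith
  positivity

lemma sigmaR_nonneg {R : Module.End ℝ (so n)} (hR : isCurvOp R) : 0 ≤ sigmaR R := by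
  refine div_nonneg (Finset.sum_nonneg fun i _ => ?_) (Nat.cast_nonneg n)
  rw [Matrix.diag, Matrix.mul_apply]
  refine Finset.sum_nonneg fun j _ => ?_
  rw [Ric0_symm hR i j]
  exact mul_self_nonneg _

lemma Ric0_eq_zero (hn : n ≠ 0) {R : Module.End ℝ (so n)} (hR : isCurvOp R)
    (h : sigmaR R = 0) : Ric0 R = 0 := by
  have ht := trace_Ric0_sq hn R
  rw [h, mul_zero] at ht
  have hnn : ∀ i j, 0 ≤ Ric0 R i j * Ric0 R j i := fun i j => by
    rw [Ric0_symm hR i j]; exact mul_self_nonneg _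
  simp only [Matrix.trace, Matrix.diag, Matrix.mul_apply] at ht
  ext i j
  have h1 := (Finset.sum_eq_zero_iff_of_nonneg
    (fun i _ => Finset.sum_nonneg fun k _ => hnn i k)).1 ht i (Finset.mem_univ _)
  have h2 := (Finset.sum_eq_zero_iff_of_nonneg (fun k _ => hnn i k)).1 h1 j (Finset.mem_univ _)
  rw [Ric0_symm hR i j] at h2
  exact mul_self_eq_zero.1 h2

lemma Dab_eq {a b p : ℝ} (h : (((n : ℝ) - 2) * b ^ 2 + 2 * b) * (1 - p) = 2 * a)
    (R : Module.End ℝ (so n)) {P : Mat n} (hP : P = Ric0 R + ((1 - p) * lamb R) • (1 : Mat n)) :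
    Dab a b R = (((n : ℝ) - 2) * b ^ 2 + 2 * b) • wedge P P
      + (2 * b ^ 2) • wedge (Ric0 R * Ric0 R) 1
      + (2 * a * lamb R ^ 2 * p + kap n a b * sigmaR R) • wedge 1 1 := by
  refine end_ext_Rcoord fun i j k l => ?_
  simp only [Dab, Rcoord_add, Rcoord_smul, Rcoord_wedge, hP]
  have e : wedgeTensor (Ric0 R + ((1 - p) * lamb R) • (1 : Mat n))
      (Ric0 R + ((1 - p) * lamb R) • (1 : Mat n)) i j k l
      = wedgeTensor (Ric0 R) (Ric0 R) i j k l
        + 2 * ((1 - p) * lamb R) * wedgeTensor (Ric0 R) 1 i j k l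
        + ((1 - p) * lamb R) ^ 2 * wedgeTensor 1 1 i j k l := by
    simp only [wedgeTensor, Matrix.add_apply, Matrix.smul_apply, smul_eq_mul]
    ring
  rw [e]
  linear_combination (-(2 * lamb R * wedgeTensor (Ric0 R) 1 i j k l)
    - (1 - p) * lamb R ^ 2 * wedgeTensor 1 1 i j k l) * h

lemma RicM_sub_eq (hn : n ≠ 0) {a b p : ℝ} (h : 2 * a = p + 2 * b * (1 - p)) (c : ℝ)
    {R : Module.End ℝ (so n)} (hR : isCurvOp R) {P : Mat n}
    (hP : P = Ric0 R + ((1 - p) * lamb R) • (1 : Mat n)) :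
    RicM (Qode R + Dab a b R + c • R)
        - (p * lamb (Qode R + Dab a b R + c • R)) • (1 : Mat n)
      = contractTensor (Rcoord R) P + (-2 * b) • (P * P)
        + (4 * b * (1 - p) * lamb R + p * lamb R + 2 * a * lamb R * (n - 2) + c) • P
        + (((1 - p) * (b ^ 2 * n + (n - 1) * kap n a b) - p + 2 * b * p) * sigmaR R)
          • (1 : Mat n) := by
  have hRic : RicM R = P + (p * lamb R) • (1 : Mat n) := by
    rw [RicM_eq_Ric0_add, hP, add_assoc, ← add_smul]; congr 2; ring
  have hN : Ric0 R = P - ((1 - p) * lamb R) • (1 : Mat n) := by rw [hP]; simp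
  simp only [RicM_add, RicM_smul, lamb_add, lamb_smul, RicM_Qode hR, lamb_Qode hn hR,
    RicM_Dab hn a b hR, lamb_Dab hn a b hR]
  have hc : contractTensor (Rcoord R) (RicM R) = contractTensor (Rcoord R) P
      + (p * lamb R) • RicM R := by
    conv_lhs => rw [hRic]
    rw [contractTensor_add, contractTensor_smul, contractTensor_one, ← RicM_eq_ricTensor]
  rw [hc, hRic, hN]
  ext i j
  simp only [sub_mul, mul_sub, Matrix.smul_mul, Matrix.mul_smul, mul_one, one_mul,
    Matrix.add_apply, Matrix.sub_apply, Matrix.smul_apply, smul_eq_mul]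
  linear_combination ((1 - p) * lamb R ^ 2 * (1 : Mat n) i j) * h

theorem exists_pos_lower_bound (hn : 3 ≤ n) {a b p : ℝ} (hb : b ∈ Set.Ioc (0 : ℝ) (1 / 2))
    (ha : a = (((n : ℝ) - 2) * b ^ 2 + 2 * b) / (2 + 2 * ((n : ℝ) - 2) * b ^ 2))
    (hp : p = ((n : ℝ) - 2) * b ^ 2 / (1 + ((n : ℝ) - 2) * b ^ 2))
    {R : Module.End ℝ (so n)} (hR : R ∈ Cpinch n p) (h0 : R ≠ 0) :
    ∃ c > (0 : ℝ), ∃ δ > (0 : ℝ), (∀ X, δ * ip X X ≤ ip ((Qode R + Dab a b R + c • R) X) X) ∧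
      ∀ v : Fin n → ℝ, δ * (v ⬝ᵥ v) ≤ v ⬝ᵥ ((RicM (Qode R + Dab a b R + c • R)
        - (p * lamb (Qode R + Dab a b R + c • R)) • (1 : Mat n)) *ᵥ v) := by
  obtain ⟨ha0, hp0, hp1, hq, h2a, hk, hg⟩ := param_relations hn hb ha hp
  obtain ⟨hC, hpos, hRic⟩ := hR
  have hn0 : n ≠ 0 := by omega
  have hn' : (3 : ℝ) ≤ n := by exact_mod_cast hn
  have hb0 := hb.1
  have hl : 0 < lamb R := lamb_pos hn0 hC.1 hpos h0
  have hσ := sigmaR_nonneg hC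
  have hs : 0 < 1 - p := by linarith
  set g := (1 - p) * (b ^ 2 * n + (n - 1) * kap n a b) - p + 2 * b * p with hgdef
  obtain ⟨P, hP⟩ : ∃ P, P = Ric0 R + ((1 - p) * lamb R) • (1 : Mat n) := ⟨_, rfl⟩
  have hPpsd : P.PosSemidef := by
    have : P = RicM R - (p * (Matrix.trace (RicM R) / (n : ℝ))) • (1 : Mat n) := by
      rw [hP, Ric0, ← lamb]; module
    rw [this]; exact hRic
  have hPv : ∀ v : Fin n → ℝ, 0 ≤ v ⬝ᵥ (P *ᵥ v) := fun v => by
    simpa using hPpsd.dotProduct_mulVec_nonneg v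
  have hvv : ∀ v : Fin n → ℝ, 0 ≤ v ⬝ᵥ v := fun v => Finset.sum_nonneg fun i _ =>
    mul_self_nonneg _
  have htrP : Matrix.trace P = n * ((1 - p) * lamb R) := by
    rw [hP, Matrix.trace_add, trace_Ric0 hn0, Matrix.trace_smul, trace_one_fin, smul_eq_mul]
    ring
  have htrP0 : 0 ≤ Matrix.trace P := by rw [htrP]; positivity
  obtain ⟨δ₂, hδ₂, hδ₂v⟩ : ∃ δ > 0, ∀ v : Fin n → ℝ,
      δ * (v ⬝ᵥ v) ≤ v ⬝ᵥ (P *ᵥ v) + g * sigmaR R * (v ⬝ᵥ v) := by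
    rcases hσ.eq_or_lt with h | h
    · refine ⟨(1 - p) * lamb R, by positivity, fun v => ?_⟩
      rw [hP, Ric0_eq_zero hn0 hC h.symm, zero_add, Matrix.smul_mulVec, Matrix.one_mulVec,
        dotProduct_smul, ← h, smul_eq_mul]
      linarith
    · refine ⟨g * sigmaR R, by positivity, fun v => ?_⟩
      linarith [hPv v]
  refine ⟨2 * b * Matrix.trace P + 1, by positivity, min (2 * a * lamb R ^ 2 * p) δ₂,
    lt_min (by positivity) hδ₂, fun X => ?_, fun v => ?_⟩
  · have h1 := Qode_nonneg hC.1 hpos X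
    have h2 := wedge_self_nonneg hPpsd X
    have h3 := wedge_sq_one_nonneg (Ric0_symm hC) X
    have h4 := ip_self_nonneg X
    have h5 := hpos X
    rw [Dab_eq hq R hP]
    simp only [LinearMap.add_apply, LinearMap.smul_apply, ip_add_left, ip_smul_left,
      wedge_one_one]
    have hm : min (2 * a * lamb R ^ 2 * p) δ₂ * ip X X ≤ 2 * a * lamb R ^ 2 * p * ip X X :=
      mul_le_mul_of_nonneg_right (min_le_left _ _) h4
    have h6 : 0 ≤ (((n : ℝ) - 2) * b ^ 2 + 2 * b) * ip (wedge P P X) X :=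
      mul_nonneg (by nlinarith [sq_nonneg b]) h2
    have h7 : 0 ≤ 2 * b ^ 2 * ip (wedge (Ric0 R * Ric0 R) 1 X) X := by positivity
    have h8 : 0 ≤ kap n a b * sigmaR R * ip X X := by positivity
    have h9 : 0 ≤ (2 * b * Matrix.trace P + 1) * ip (R X) X := by positivity
    linarith
  · rw [RicM_sub_eq hn0 h2a _ hC hP]
    simp only [Matrix.add_mulVec, Matrix.smul_mulVec, dotProduct_add, dotProduct_smul,
      smul_eq_mul, Matrix.one_mulVec]
    have h1 := contractTensor_nonneg hC.1 hpos hPpsd v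
    have h2 := mul_le_mul_of_nonneg_left (dotProduct_mul_self_le hPpsd v)
      (show 0 ≤ 2 * b by positivity)
    have h3 : min (2 * a * lamb R ^ 2 * p) δ₂ * (v ⬝ᵥ v) ≤ δ₂ * (v ⬝ᵥ v) :=
      mul_le_mul_of_nonneg_right (min_le_right _ _) (hvv v)
    have h4 : 0 ≤ (4 * b * (1 - p) * lamb R + p * lamb R + 2 * a * lamb R * (n - 2))
        * (v ⬝ᵥ (P *ᵥ v)) := by
      have : 0 < (n : ℝ) - 2 := by linarith
      have := hPv v
      positivity
    have h5 := hδ₂v v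
    linarith

lemma Ric0_add (R S : Module.End ℝ (so n)) : Ric0 (R + S) = Ric0 R + Ric0 S := by
  rw [Ric0, RicM_add, lamb_add, Ric0, Ric0]; module

lemma Ric0_smul (c : ℝ) (R : Module.End ℝ (so n)) : Ric0 (c • R) = c • Ric0 R := by
  rw [Ric0, RicM_smul, lamb_smul, Ric0]; module

lemma lab_add (hn : 3 ≤ n) (a b : ℝ) (R S : Module.End ℝ (so n)) :
    lab a b (R + S) = lab a b R + lab a b S := by
  refine end_ext_Rcoord fun i j k l => ?_
  rw [Rcoord_add, Rcoord_lab hn, Rcoord_lab hn, Rcoord_lab hn, Rcoord_add, Ric0_add, lamb_add]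
  simp only [wedgeTensor, Matrix.add_apply, Matrix.smul_apply, smul_eq_mul]
  ring

lemma lab_smul (hn : 3 ≤ n) (a b c : ℝ) (R : Module.End ℝ (so n)) :
    lab a b (c • R) = c • lab a b R := by
  refine end_ext_Rcoord fun i j k l => ?_
  rw [Rcoord_smul, Rcoord_lab hn, Rcoord_lab hn, Rcoord_smul, Ric0_smul, lamb_smul]
  simp only [wedgeTensor, Matrix.add_apply, Matrix.smul_apply, smul_eq_mul]
  ring

lemma RicM_lab (hn : 3 ≤ n) (a b : ℝ) {R : Module.End ℝ (so n)} (hR : isCurvOp R) :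
    RicM (lab a b R) = (1 + (n - 2) * b) • Ric0 R
      + ((1 + 2 * (n - 1) * a) * lamb R) • (1 : Mat n) := by
  have hn0 : n ≠ 0 := by omega
  rw [lab_eq hn, RicM_add, RicM_wedge (fun i j => by
    simp only [Matrix.add_apply, Matrix.smul_apply, Ric0_symm hR i j, one_apply_comm i j])
    one_apply_comm, RicM_eq_Ric0_add]
  simp only [Matrix.trace_add, Matrix.trace_smul, trace_Ric0 hn0, trace_one_fin, smul_eq_mul,
    mul_one, one_mul]
  module

lemma lamb_lab (hn : 3 ≤ n) (a b : ℝ) {R : Module.End ℝ (so n)} (hR : isCurvOp R) :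
    lamb (lab a b R) = (1 + 2 * (n - 1) * a) * lamb R := by
  have hn0 : n ≠ 0 := by omega
  have h0 : (n : ℝ) ≠ 0 := Nat.cast_ne_zero.mpr hn0
  rw [lamb, RicM_lab hn a b hR]
  simp only [Matrix.trace_add, Matrix.trace_smul, trace_Ric0 hn0, trace_one_fin, smul_eq_mul]
  field_simp
  ring

lemma Ric0_lab (hn : 3 ≤ n) (a b : ℝ) {R : Module.End ℝ (so n)} (hR : isCurvOp R) :
    Ric0 (lab a b R) = (1 + (n - 2) * b) • Ric0 R := by
  rw [Ric0, RicM_lab hn a b hR, lamb_lab hn a b hR]; simp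

/-- The inverse of `ℓ_{a,b}` is again of the form `ℓ_{a',b'}`. -/
lemma lab_lab_cancel (hn : 3 ≤ n) {a b : ℝ} (ha : 1 + 2 * ((n : ℝ) - 1) * a ≠ 0)
    (hb : 1 + ((n : ℝ) - 2) * b ≠ 0) {R : Module.End ℝ (so n)} (hR : isCurvOp R) :
    lab a b (lab (-a / (1 + 2 * (n - 1) * a)) (-b / (1 + (n - 2) * b)) R) = R := by
  refine end_ext_Rcoord fun i j k l => ?_
  rw [Rcoord_lab hn, Ric0_lab hn _ _ hR, lamb_lab hn _ _ hR, Rcoord_lab hn]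
  have h1 : 1 + 2 * ((n : ℝ) - 1) * (-a / (1 + 2 * (n - 1) * a)) = 1 / (1 + 2 * (n - 1) * a) := by
    field_simp; ring
  have h2 : 1 + ((n : ℝ) - 2) * (-b / (1 + (n - 2) * b)) = 1 / (1 + (n - 2) * b) := by
    field_simp; ring
  rw [h1, h2]
  simp only [wedgeTensor, Matrix.add_apply, Matrix.smul_apply, smul_eq_mul]
  ring

lemma abs_quadratic_le {ι : Type*} [Fintype ι] {A : ι → ι → ℝ} {η : ℝ}
    (hA : ∀ s t, |A s t| ≤ η) (x : ι → ℝ) :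
    |∑ s, ∑ t, x s * A s t * x t| ≤ η * Fintype.card ι * ∑ s, x s ^ 2 := by
  have h : ∀ s t, |x s * A s t * x t| ≤ η * ((x s ^ 2 + x t ^ 2) / 2) := by
    intro s t
    have h1 : |x s * A s t * x t| = |A s t| * (|x s| * |x t|) := by
      rw [abs_mul, abs_mul]; ring
    rw [h1]
    refine mul_le_mul (hA s t) ?_ (by positivity) ((abs_nonneg _).trans (hA s t))
    have := sq_nonneg (|x s| - |x t|)
    rw [← sq_abs (x s), ← sq_abs (x t)]
    linarith
  calc |∑ s, ∑ t, x s * A s t * x t| ≤ ∑ s, ∑ t, |x s * A s t * x t| :=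
        (Finset.abs_sum_le_sum_abs _ _).trans
          (Finset.sum_le_sum fun s _ => Finset.abs_sum_le_sum_abs _ _)
    _ ≤ ∑ s, ∑ t, η * ((x s ^ 2 + x t ^ 2) / 2) :=
        Finset.sum_le_sum fun s _ => Finset.sum_le_sum fun t _ => h s t
    _ = η * Fintype.card ι * ∑ s, x s ^ 2 := by
        simp only [← Finset.mul_sum, ← Finset.sum_div, Finset.sum_add_distrib,
          Finset.sum_const, Finset.card_univ, nsmul_eq_mul]
        ring

lemma abs_ip_apply_self_le {F : Module.End ℝ (so n)} {η : ℝ}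
    (hF : ∀ i j k l, |Rcoord F i j k l| ≤ η) (X : so n) :
    |ip (F X) X| ≤ η * n ^ 2 * ip X X := by
  have hη : 0 ≤ η * n ^ 2 * ip X X := by
    rcases Nat.eq_zero_or_pos n with rfl | h
    · simp
    · have := (abs_nonneg _).trans (hF ⟨0, h⟩ ⟨0, h⟩ ⟨0, h⟩ ⟨0, h⟩)
      have := ip_self_nonneg X
      positivity
  have h := abs_quadratic_le (ι := Fin n × Fin n) (A := fun s t => Rcoord F t.1 t.2 s.1 s.2)
    (fun s t => hF _ _ _ _) fun s => (X : Mat n) s.1 s.2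
  simp only [Fintype.sum_prod_type, Fintype.card_prod, Fintype.card_fin, Nat.cast_mul] at h
  have e : ip (F X) X = (1 / 4) * ∑ k, ∑ l, ∑ i, ∑ j,
      (X : Mat n) k l * Rcoord F i j k l * (X : Mat n) i j := by
    rw [ip_apply_eq_sum]
    congr 1
    refine Finset.sum_congr rfl fun k _ => Finset.sum_congr rfl fun l _ =>
      Finset.sum_congr rfl fun i _ => Finset.sum_congr rfl fun j _ => ?_
    ring
  have e2 : ∑ k, ∑ l, (X : Mat n) k l ^ 2 = 2 * ip X X := by
    rw [ip_eq_sum]; simp only [sq]; ring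
  rw [e2] at h
  rw [e, abs_mul, abs_of_pos (by norm_num : (0 : ℝ) < 1 / 4)]
  linarith

lemma abs_dotProduct_mulVec_le {A : Mat n} {η : ℝ} (hA : ∀ i j, |A i j| ≤ η) (v : Fin n → ℝ) :
    |v ⬝ᵥ (A *ᵥ v)| ≤ η * n * (v ⬝ᵥ v) := by
  have h := abs_quadratic_le hA v
  have e : v ⬝ᵥ (A *ᵥ v) = ∑ s, ∑ t, v s * A s t * v t := by
    simp only [dotProduct, Matrix.mulVec, Finset.mul_sum, mul_assoc]
  rw [e]
  simpa [dotProduct, sq] using h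

lemma abs_Rcoord_le (E : Module.End ℝ (so n)) (i j k l : Fin n) :
    |Rcoord E i j k l| ≤ 2 * endNorm E := by
  have h1 : ∑ p ∈ pairs n, ip (E (bvec p.1 p.2)) (E (bvec p.1 p.2))
      = (1 / 2) * ∑ i, ∑ j, ip (E (bvec i j)) (E (bvec i j)) := by
    refine sum_pairs (fun i j => ip (E (bvec i j)) (E (bvec i j))) (fun i j => ?_) fun i => ?_
    · simp only [ip_eq_sum, bvec_swap i j, map_neg, Submodule.coe_neg, Matrix.neg_apply,
        neg_mul_neg]
    · simp only [ip_eq_sum, bvec_self, map_zero, Submodule.coe_zero, Matrix.zero_apply, mul_zero,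
        Finset.sum_const_zero]
  have h2 : Rcoord E i j k l ^ 2 ≤ 2 * ip (E (bvec i j)) (E (bvec i j)) := by
    rw [ip_eq_sum, Rcoord_eq, sq]
    have h3 := Finset.single_le_sum (f := fun k => ∑ l, (E (bvec i j) : Mat n) k l
      * (E (bvec i j) : Mat n) k l) (fun k _ => Finset.sum_nonneg fun l _ => mul_self_nonneg _)
      (Finset.mem_univ k)
    have h4 := Finset.single_le_sum (f := fun l => (E (bvec i j) : Mat n) k l
      * (E (bvec i j) : Mat n) k l) (fun l _ => mul_self_nonneg _) (Finset.mem_univ l)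
    linarith [h4.trans h3]
  have h5 := Finset.single_le_sum (f := fun i => ∑ j, ip (E (bvec i j)) (E (bvec i j)))
      (fun i _ => Finset.sum_nonneg fun j _ => ip_self_nonneg _) (Finset.mem_univ i)
  have h6 := Finset.single_le_sum (f := fun j => ip (E (bvec i j)) (E (bvec i j)))
      (fun j _ => ip_self_nonneg _) (Finset.mem_univ j)
  have h7 : Rcoord E i j k l ^ 2 ≤ 2 ^ 2
      * ∑ p ∈ pairs n, ip (E (bvec p.1 p.2)) (E (bvec p.1 p.2)) := by
    rw [h1]; linarith [h6.trans h5]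
  rw [endNorm, ← Real.sqrt_sq (zero_le_two (α := ℝ)), ← Real.sqrt_mul (by positivity)]
  exact Real.abs_le_sqrt h7

lemma Rcoord_zero (i j k l : Fin n) : Rcoord (0 : Module.End ℝ (so n)) i j k l = 0 := by
  simp [Rcoord_eq]

lemma end_sub_self (R : Module.End ℝ (so n)) : R - R = 0 :=
  end_ext_Rcoord fun i j k l => by rw [Rcoord_sub, sub_self, Rcoord_zero]

lemma isCurvOp_sub {R S : Module.End ℝ (so n)} (hR : isCurvOp R) (hS : isCurvOp S) :
    isCurvOp (R - S) := by
  have e : R - S = R + (-1 : ℝ) • S := end_ext_Rcoord fun i j k l => by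
    rw [Rcoord_sub, Rcoord_add, Rcoord_smul]; ring
  rw [e]
  exact isCurvOp_add hR (isCurvOp_smul _ hS)

lemma endNorm_zero : endNorm (0 : Module.End ℝ (so n)) = 0 := by
  simp [endNorm, ip_eq_sum]

lemma abs_RicM_le {E : Module.End ℝ (so n)} {ε : ℝ} (hE : ∀ i j k l, |Rcoord E i j k l| ≤ ε)
    (i j : Fin n) : |RicM E i j| ≤ n * ε := by
  rw [RicM, Matrix.of_apply]
  refine (Finset.abs_sum_le_sum_abs _ _).trans ((Finset.sum_le_sum fun k _ => hE _ _ _ _).trans ?_)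
  simp

lemma abs_lamb_le (hn : n ≠ 0) {E : Module.End ℝ (so n)} {ε : ℝ}
    (hE : ∀ i j k l, |Rcoord E i j k l| ≤ ε) : |lamb E| ≤ n * ε := by
  have h0 : (0 : ℝ) < n := by exact_mod_cast Nat.pos_of_ne_zero hn
  rw [lamb, abs_div, abs_of_pos h0, div_le_iff₀ h0, Matrix.trace]
  refine (Finset.abs_sum_le_sum_abs _ _).trans
    ((Finset.sum_le_sum fun i _ => abs_RicM_le hE i i).trans ?_)
  simp only [Finset.sum_const, Finset.card_univ, Fintype.card_fin, nsmul_eq_mul]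
  linarith

lemma abs_one_apply_le (i j : Fin n) : |(1 : Mat n) i j| ≤ 1 := by
  rw [Matrix.one_apply]; split_ifs <;> simp

lemma abs_sub_smul_one_le {A : Mat n} {η t θ : ℝ} (hA : ∀ i j, |A i j| ≤ η) (ht : |t| ≤ θ)
    (i j : Fin n) : |(A + t • (1 : Mat n)) i j| ≤ η + θ := by
  rw [Matrix.add_apply, Matrix.smul_apply, smul_eq_mul]
  refine (abs_add_le _ _).trans (add_le_add (hA i j) ?_)
  rw [abs_mul]
  exact (mul_le_of_le_one_right (abs_nonneg _) (abs_one_apply_le i j)).trans ht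

lemma abs_wedgeTensor_one_le {M : Mat n} {η : ℝ} (hM : ∀ i j, |M i j| ≤ η) (i j k l : Fin n) :
    |wedgeTensor M 1 i j k l| ≤ 2 * η := by
  have h : ∀ i j k l, |M i j * (1 : Mat n) k l| ≤ η := fun i j k l => by
    rw [abs_mul]
    exact (mul_le_of_le_one_right (abs_nonneg _) (abs_one_apply_le k l)).trans (hM i j)
  have h1 := abs_le.1 (h k i l j)
  have h2 := abs_le.1 (h k j l i)
  have h3 := abs_le.1 (h l j k i)
  have h4 := abs_le.1 (h l i k j)
  rw [wedgeTensor, abs_le]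
  constructor <;> linarith [h1.1, h1.2, h2.1, h2.2, h3.1, h3.2, h4.1, h4.2]

lemma exists_abs_Rcoord_lab_le (hn : 3 ≤ n) (a b : ℝ) :
    ∃ K > (0 : ℝ), ∀ (E : Module.End ℝ (so n)) (ε : ℝ), (∀ i j k l, |Rcoord E i j k l| ≤ ε) →
      ∀ i j k l, |Rcoord (lab a b E) i j k l| ≤ K * ε := by
  have hn0 : n ≠ 0 := by omega
  refine ⟨1 + 2 * (|2 * b| * (n + n) + |2 * a| * n), by positivity, fun E ε hE i j k l => ?_⟩
  have hl := abs_lamb_le hn0 hE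
  have hN : ∀ i j, |((2 * b) • Ric0 E) i j| ≤ |2 * b| * (n * ε + n * ε) := by
    intro i j
    rw [Matrix.smul_apply, smul_eq_mul, abs_mul]
    refine mul_le_mul_of_nonneg_left ?_ (abs_nonneg _)
    rw [Ric0, sub_eq_add_neg, ← neg_smul]
    exact abs_sub_smul_one_le (abs_RicM_le hE) (by rwa [abs_neg]) i j
  have hM := abs_sub_smul_one_le hN (t := 2 * a * lamb E) (θ := |2 * a| * (n * ε)) (by
    rw [abs_mul]; exact mul_le_mul_of_nonneg_left hl (abs_nonneg _))
  rw [Rcoord_lab hn]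
  refine (abs_add_le _ _).trans ((add_le_add (hE i j k l)
    (abs_wedgeTensor_one_le hM i j k l)).trans_eq ?_)
  ring

lemma smul_mem_Cpinch {p c : ℝ} (hc : 0 ≤ c) {R : Module.End ℝ (so n)} (hR : R ∈ Cpinch n p) :
    c • R ∈ Cpinch n p := by
  refine ⟨isCurvOp_smul c hR.1, fun X => ?_, ?_⟩
  · rw [LinearMap.smul_apply, ip_smul_left]
    exact mul_nonneg hc (hR.2.1 X)
  · have h := hR.2.2.smul hc
    convert h using 1
    rw [RicM_smul, Matrix.trace_smul, smul_sub, smul_eq_mul, smul_smul]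
    congr 2; ring

lemma mem_Cpinch_of_forall {p : ℝ} {R : Module.End ℝ (so n)} (hR : isCurvOp R)
    (hpos : posSemidefEnd R)
    (hRic : ∀ v : Fin n → ℝ, 0 ≤ v ⬝ᵥ ((RicM R - (p * lamb R) • (1 : Mat n)) *ᵥ v)) :
    R ∈ Cpinch n p := by
  refine ⟨hR, hpos, Matrix.PosSemidef.of_dotProduct_mulVec_nonneg ?_ fun v => ?_⟩
  · ext i j
    simp only [Matrix.conjTranspose_apply, Matrix.sub_apply, Matrix.smul_apply, star_trivial,
      RicM_symm hR i j, one_apply_comm i j]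
  · rw [star_trivial]; exact hRic v

/-- A lower bound on the quadratic forms defining `C(p)` yields a neighbourhood of the
corresponding curvature operator inside `C(p)`. -/
lemma exists_add_mem_Cpinch (hn : n ≠ 0) (p : ℝ) {Z : Module.End ℝ (so n)} (hZ : isCurvOp Z)
    {δ : ℝ} (hδ : 0 < δ) (h1 : ∀ X, δ * ip X X ≤ ip (Z X) X)
    (h2 : ∀ v : Fin n → ℝ,
      δ * (v ⬝ᵥ v) ≤ v ⬝ᵥ ((RicM Z - (p * lamb Z) • (1 : Mat n)) *ᵥ v)) :
    ∃ η > (0 : ℝ), ∀ F, isCurvOp F → (∀ i j k l, |Rcoord F i j k l| ≤ η) →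
      Z + F ∈ Cpinch n p := by
  have h0 : (0 : ℝ) < n := by exact_mod_cast Nat.pos_of_ne_zero hn
  have hvv : ∀ v : Fin n → ℝ, 0 ≤ v ⬝ᵥ v := fun v => Finset.sum_nonneg fun i _ =>
    mul_self_nonneg _
  refine ⟨δ / (n ^ 2 * (1 + |p|)), by positivity, fun F hF hη =>
    mem_Cpinch_of_forall (isCurvOp_add hZ hF) (fun X => ?_) fun v => ?_⟩
  · rw [LinearMap.add_apply, ip_add_left]
    have h3 := (abs_le.1 (abs_ip_apply_self_le hη X)).1
    have h4 : δ / (n ^ 2 * (1 + |p|)) * n ^ 2 * ip X X ≤ δ * ip X X := by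
      refine mul_le_mul_of_nonneg_right ?_ (ip_self_nonneg X)
      have : δ / (n ^ 2 * (1 + |p|)) * n ^ 2 = δ / (1 + |p|) := by field_simp
      rw [this]
      exact div_le_self hδ.le (by linarith [abs_nonneg p])
    linarith [h1 X]
  · have e : RicM (Z + F) - (p * lamb (Z + F)) • (1 : Mat n)
        = (RicM Z - (p * lamb Z) • (1 : Mat n)) + (RicM F + (-(p * lamb F)) • (1 : Mat n)) := by
      rw [RicM_add, lamb_add]; module
    have hA := abs_sub_smul_one_le (abs_RicM_le hη) (t := -(p * lamb F))
      (θ := |p| * (n * (δ / (n ^ 2 * (1 + |p|))))) (by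
        rw [abs_neg, abs_mul]
        exact mul_le_mul_of_nonneg_left (abs_lamb_le hn hη) (abs_nonneg _))
    have h3 := (abs_le.1 (abs_dotProduct_mulVec_le hA v)).1
    have h4 : (n * (δ / (n ^ 2 * (1 + |p|))) + |p| * (n * (δ / (n ^ 2 * (1 + |p|))))) * n = δ := by
      field_simp
    rw [h4] at h3
    rw [e, Matrix.add_mulVec, dotProduct_add]
    linarith [h2 v]

/-- If `c·R` can be absorbed, the image of the translate lies in the tangent cone. -/
lemma mem_tangCone_of_add_mem (hn : 3 ≤ n) {a b p c : ℝ} (hc : 0 < c)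
    {R W : Module.End ℝ (so n)} (h : W + c • R ∈ Cpinch n p) :
    lab a b W ∈ tangCone (lab a b '' Cpinch n p) (lab a b R) := by
  intro ε hε
  refine ⟨lab a b (c⁻¹ • (W + c • R)), ⟨_, smul_mem_Cpinch (inv_nonneg.2 hc.le) h, rfl⟩, c,
    hc.le, ?_⟩
  have e : lab a b W - c • (lab a b (c⁻¹ • (W + c • R)) - lab a b R) = 0 := by
    refine end_ext_Rcoord fun i j k l => ?_
    rw [lab_smul hn, lab_add hn, lab_smul hn]
    simp only [Rcoord_sub, Rcoord_smul, Rcoord_add, Rcoord_zero]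
    field_simp
    ring
  rw [e, endNorm_zero]
  exact hε

theorem Qode_mem_interiorCurv (hn : 3 ≤ n) {a b p : ℝ} (hb : b ∈ Set.Ioc (0 : ℝ) (1 / 2))
    (ha : a = (((n : ℝ) - 2) * b ^ 2 + 2 * b) / (2 + 2 * ((n : ℝ) - 2) * b ^ 2))
    (hp : p = ((n : ℝ) - 2) * b ^ 2 / (1 + ((n : ℝ) - 2) * b ^ 2))
    {R : Module.End ℝ (so n)} (hR : R ∈ Cpinch n p) (h0 : R ≠ 0) :
    Qode (lab a b R) ∈ interiorCurv (tangCone (lab a b '' Cpinch n p) (lab a b R)) := by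
  obtain ⟨ha0, -⟩ := param_relations hn hb ha hp
  have hn' : (3 : ℝ) ≤ n := by exact_mod_cast hn
  have hb0 := hb.1
  have hn1 : 0 < (n : ℝ) - 1 := by linarith
  have hn2 : 0 < (n : ℝ) - 2 := by linarith
  have ha1 : 1 + 2 * ((n : ℝ) - 1) * a ≠ 0 := by positivity
  have hb1 : 1 + ((n : ℝ) - 2) * b ≠ 0 := by positivity
  have hC := hR.1
  obtain ⟨c, hc, δ, hδ, h1, h2⟩ := exists_pos_lower_bound hn hb ha hp hR h0
  obtain ⟨η, hη, hF⟩ := exists_add_mem_Cpinch (by omega) p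
    (isCurvOp_add (isCurvOp_add (isCurvOp_Qode hC) (isCurvOp_Dab a b hC)) (isCurvOp_smul c hC))
    hδ h1 h2
  obtain ⟨K, hK, hlab⟩ := exists_abs_Rcoord_lab_le hn (-a / (1 + 2 * (n - 1) * a))
    (-b / (1 + (n - 2) * b))
  have hQ : isCurvOp (Qode (lab a b R)) := isCurvOp_Qode (isCurvOp_lab hn a b hC)
  refine ⟨hQ, η / (2 * K), by positivity, fun Y hY hlt => ?_⟩
  have hE : isCurvOp (Y - Qode (lab a b R)) := isCurvOp_sub hY hQ
  set F := lab (-a / (1 + 2 * (n - 1) * a)) (-b / (1 + (n - 2) * b)) (Y - Qode (lab a b R))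
    with hFdef
  have hFE : lab a b F = Y - Qode (lab a b R) := lab_lab_cancel hn ha1 hb1 hE
  have hmem := hF F (isCurvOp_lab hn _ _ hE) fun i j k l => by
    refine (hlab _ _ (abs_Rcoord_le _) i j k l).trans ?_
    rw [lt_div_iff₀ (by positivity)] at hlt
    linarith
  have hYeq : Y = lab a b (Qode R + Dab a b R + F) := by
    rw [lab_add hn, lab_Qode_add_Dab hn a b ha1 hC, hFE]
    exact end_ext_Rcoord fun i j k l => by rw [Rcoord_add, Rcoord_sub]; ring
  rw [hYeq]
  refine mem_tangCone_of_add_mem hn hc ?_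
  rw [add_right_comm]
  exact hmem

lemma lab_zero (hn : 3 ≤ n) (a b : ℝ) : lab a b (0 : Module.End ℝ (so n)) = 0 := by
  simpa using lab_smul hn a b 0 (0 : Module.End ℝ (so n))

lemma Qode_zero : Qode (0 : Module.End ℝ (so n)) = 0 := by
  refine end_ext_Rcoord fun i j k l => ?_
  rw [Rcoord_Qode (fun X Y => by simp [ip_eq_sum])]
  simp [quadTensor, Rcoord_eq]

/-- Lemma (first family): `ℓ_{a,b}(C(p))` is invariant under the ODE `dR/dt = R² + R^#`,
and transverse to the boundary at nonzero boundary points. -/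
theorem stmt_15 {n : ℕ} (hn : 3 ≤ n) (b : ℝ) (hb : b ∈ Set.Ioc (0 : ℝ) (1 / 2))
    (a p : ℝ)
    (ha : a = (((n : ℝ) - 2) * b ^ 2 + 2 * b) / (2 + 2 * ((n : ℝ) - 2) * b ^ 2))
    (hp : p = ((n : ℝ) - 2) * b ^ 2 / (1 + ((n : ℝ) - 2) * b ^ 2)) :
    (∀ S ∈ lab a b '' Cpinch n p, Qode S ∈ tangCone (lab a b '' Cpinch n p) S) ∧
      ∀ S ∈ lab a b '' Cpinch n p, S ≠ 0 →
        Qode S ∈ interiorCurv (tangCone (lab a b '' Cpinch n p) S) := by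
  have hint : ∀ S ∈ lab a b '' Cpinch n p, S ≠ 0 →
      Qode S ∈ interiorCurv (tangCone (lab a b '' Cpinch n p) S) := by
    rintro S ⟨R, hR, rfl⟩ hS
    exact Qode_mem_interiorCurv hn hb ha hp hR fun h => hS (by rw [h, lab_zero hn])
  refine ⟨fun S hS => ?_, hint⟩
  rcases eq_or_ne S 0 with rfl | h
  · refine fun ε hε => ⟨0, hS, 0, le_rfl, ?_⟩
    rwa [Qode_zero, zero_smul, end_sub_self, endNorm_zero]
  · obtain ⟨hQ, ε, hε, hball⟩ := hint S hS h
    exact hball _ hQ (by rwa [end_sub_self, endNorm_zero])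

end BW
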